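/- arXiv:1011.0395 — 7 statements merged into one kernel-verified Lean document; each statement's English description precedes it below -/
import Mathlib

section
/- Let n ≥ 2 and let π be an irreducible permutation of {1,…,n}. Then the permutations a(π) and b(π) obtained from π by the Rauzy operations a and b are again irreducible permutations of {1,…,n}. -/
/-- The auxiliary permutation `q m` of `Fin n` (`0`-indexed version of the
renumbering used in the Rauzy operations): it fixes every `j ≤ m`, sends
`j ↦ j + 1` for `m < j < n - 1`, and sends the last index `n - 1` to `m + 1`.
(When `m = n - 1` it is the identity.) -/
def rauzyQ {n : ℕ} (m : Fin n) : Equiv.Perm (Fin n) :=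
  (Fin.revPerm * Fin.cycleRange ⟨n - 2 - m.val, by have := m.isLt; omega⟩ * Fin.revPerm)⁻¹

/-- Rauzy operation `a`: in the two-line representation of `π` (top line
`(0, …, n-1)`, bottom line `(π⁻¹ 0, …, π⁻¹ (n-1))`) one deletes the last entry
of the bottom line and reinserts it immediately to the right of the entry
`n - 1` of the bottom line.  In terms of permutations this is
`a(π) = q (π (n-1)) ∘ π`. -/
def rauzyA {n : ℕ} (π : Equiv.Perm (Fin n)) : Equiv.Perm (Fin n) :=
  if h : n = 0 then π else rauzyQ (π ⟨n - 1, by omega⟩) * π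

/-- Rauzy operation `b`: one deletes the last entry `n - 1` of the top line,
reinserts it immediately to the right of the entry `π⁻¹ (n-1)` of the top line
and relabels the symbols in the order of their appearance in the new top line.
In terms of permutations the relabelling map is `r = q (π⁻¹ (n-1))` and
`b(π) = π ∘ r⁻¹`. -/
def rauzyB {n : ℕ} (π : Equiv.Perm (Fin n)) : Equiv.Perm (Fin n) :=
  if h : n = 0 then π else π * (rauzyQ (π⁻¹ ⟨n - 1, by omega⟩))⁻¹

/-- Operation `c`: reverse the order of the entries in each line, interchange
the two lines and relabel so that the top line is again `(0, …, n-1)`.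
In terms of permutations, `c(π) = w ∘ π⁻¹ ∘ w` where `w : j ↦ n - 1 - j`. -/
def rauzyC {n : ℕ} (π : Equiv.Perm (Fin n)) : Equiv.Perm (Fin n) :=
  Fin.revPerm * π⁻¹ * Fin.revPerm

/-- A permutation of `{0, …, n-1}` is irreducible if it maps no proper initial
segment `{0, …, k}` (with `k < n - 1`) to itself. -/
def IrreduciblePerm {n : ℕ} (π : Equiv.Perm (Fin n)) : Prop :=
  ∀ k : ℕ, k + 1 < n → ¬ (∀ i : Fin n, i.val ≤ k → (π i).val ≤ k)

/-- The Rauzy class of `π`: the smallest set of permutations containing `π`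
and closed under the Rauzy operations `a` and `b`. -/
def RauzyClass {n : ℕ} (π : Equiv.Perm (Fin n)) : Set (Equiv.Perm (Fin n)) :=
  {σ | ∀ S : Set (Equiv.Perm (Fin n)), π ∈ S →
    (∀ τ ∈ S, rauzyA τ ∈ S) → (∀ τ ∈ S, rauzyB τ ∈ S) → σ ∈ S}

/-- The extended Rauzy class of `π`: the smallest set of permutations
containing `π` and closed under the operations `a`, `b` and `c`. -/
def RauzyClassEx {n : ℕ} (π : Equiv.Perm (Fin n)) : Set (Equiv.Perm (Fin n)) :=
  {σ | ∀ S : Set (Equiv.Perm (Fin n)), π ∈ S →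
    (∀ τ ∈ S, rauzyA τ ∈ S) → (∀ τ ∈ S, rauzyB τ ∈ S) →
    (∀ τ ∈ S, rauzyC τ ∈ S) → σ ∈ S}

theorem rauzyQ_apply_of_le {n : ℕ} {m y : Fin n} (h : y ≤ m) : rauzyQ m y = y := by
  rw [rauzyQ, Equiv.Perm.inv_eq_iff_eq, Equiv.Perm.mul_apply, Equiv.Perm.mul_apply,
    Fin.revPerm_apply, Fin.revPerm_apply]
  suffices hc : Fin.cycleRange ⟨n - 2 - m.val, by have := m.isLt; omega⟩ y.rev = y.rev by
    rw [hc, Fin.rev_rev]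
  have hm := m.isLt
  have hy := y.isLt
  rw [Fin.le_def] at h
  by_cases hlast : y.val = n - 1
  · obtain ⟨k, rfl⟩ : ∃ k, n = k + 1 := ⟨n - 1, by omega⟩
    have hzero : (⟨k + 1 - 2 - m.val, by omega⟩ : Fin (k + 1)) = 0 := by
      ext
      simp only [Fin.val_zero]
      omega
    rw [hzero, Fin.cycleRange_zero]
    rfl
  · apply Fin.cycleRange_of_gt
    rw [Fin.lt_def, Fin.val_rev]
    simp only
    omega

theorem le_of_forall_apply_le {n : ℕ} {π : Equiv.Perm (Fin n)} {k : ℕ}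
    (h : ∀ i : Fin n, i.val ≤ k → (π i).val ≤ k) {i : Fin n} (hi : (π i).val ≤ k) :
    i.val ≤ k := by
  have := Equiv.Perm.perm_symm_on_of_perm_on_finite (f := π) (p := fun i => i.val ≤ k)
    h hi
  simpa using this

theorem IrreduciblePerm.inv {n : ℕ} {π : Equiv.Perm (Fin n)} (hπ : IrreduciblePerm π) :
    IrreduciblePerm π⁻¹ := fun k hk h =>
  hπ k hk fun i hi => le_of_forall_apply_le h (by simpa using hi)

theorem IrreduciblePerm.rauzyA {n : ℕ} {π : Equiv.Perm (Fin n)} (hπ : IrreduciblePerm π) :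
    IrreduciblePerm (rauzyA π) := by
  intro k hk h
  have hn : n ≠ 0 := by omega
  have happly (i : Fin n) :
      _root_.rauzyA π i = rauzyQ (π ⟨n - 1, by omega⟩) (π i) := by
    rw [_root_.rauzyA, dif_neg hn, Equiv.Perm.mul_apply]
  by_cases hkm : k ≤ (π ⟨n - 1, by omega⟩).val
  · refine hπ k hk fun i hi => ?_
    have hle := h i hi
    rw [happly] at hle
    have hfix := rauzyQ_apply_of_le (Fin.le_def.mpr (hle.trans hkm))
    rwa [(rauzyQ _).injective hfix] at hle
  · have hlast : n - 1 ≤ k := le_of_forall_apply_le h (i := ⟨n - 1, by omega⟩) (by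
      rw [happly, rauzyQ_apply_of_le le_rfl]
      omega)
    omega

theorem rauzyB_eq_inv_rauzyA_inv {n : ℕ} (π : Equiv.Perm (Fin n)) :
    rauzyB π = (rauzyA π⁻¹)⁻¹ := by
  unfold rauzyA rauzyB
  split_ifs <;> simp

theorem IrreduciblePerm.rauzyB {n : ℕ} {π : Equiv.Perm (Fin n)} (hπ : IrreduciblePerm π) :
    IrreduciblePerm (rauzyB π) := by
  rw [rauzyB_eq_inv_rauzyA_inv]
  exact hπ.inv.rauzyA.inv

/-- If `n ≥ 2` and `π` is an irreducible permutation of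
`{1, …, n}`, then `a(π)` and `b(π)` are again irreducible permutations. -/
theorem irreduciblePerm_rauzyA_rauzyB (n : ℕ) (hn : 2 ≤ n) (π : Equiv.Perm (Fin n))
    (hπ : IrreduciblePerm π) :
    IrreduciblePerm (rauzyA π) ∧ IrreduciblePerm (rauzyB π) := by
  exact ⟨hπ.rauzyA, hπ.rauzyB⟩
end

section
/- Let n ≥ 2 and let π be an irreducible permutation of {1,…,n}. Then the permutation c(π) obtained from π by the operation c is again an irreducible permutation of {1,…,n}. -/
/-- If `n ≥ 2` and `π` is an irreducible permutation of
`{1, …, n}`, then `c(π)` is again an irreducible permutation. -/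
theorem irreduciblePerm_rauzyC (n : ℕ) (hn : 2 ≤ n) (π : Equiv.Perm (Fin n))
    (hπ : IrreduciblePerm π) :
    IrreduciblePerm (rauzyC π) := by
  intro k hk hmaps
  refine hπ (n - 2 - k) (by omega) fun i hi => ?_
  by_contra hlt
  have h := hmaps (Fin.rev (π i)) (by rw [Fin.val_rev]; omega)
  simp only [rauzyC, Equiv.Perm.mul_apply, Fin.revPerm_apply, Fin.rev_rev,
    Equiv.Perm.inv_def, Equiv.symm_apply_apply, Fin.val_rev] at h
  omega
end

section
/- Let n ≥ 2 and let π be a permutation of {1,…,n}. Then π is irreducible if and only if π⁻¹ is irreducible; moreover, if π is irreducible then π⁻¹ belongs to the extended Rauzy class R_ex(π) of π. -/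
namespace Rauzy

open Relation

variable {α : Type*}

/-! ### Rauzy moves on two-line arrays -/

/-- The Rauzy moves on a two-line array of letters, given as its top and bottom line. -/
inductive Step : List α × List α → List α × List α → Prop
  | bot (T B C : List α) (x y : α) :
      Step (T ++ [x], B ++ x :: (C ++ [y])) (T ++ [x], B ++ x :: y :: C)
  | top (T B C : List α) (x y : α) :
      Step (B ++ x :: (C ++ [y]), T ++ [x]) (B ++ x :: y :: C, T ++ [x])

/-- The two-line array `p` is connected to `q` by a sequence of Rauzy moves. -/
abbrev Conn : List α × List α → List α × List α → Prop := ReflTransGen Step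

theorem Step.swap {p q : List α × List α} (h : Step p q) : Step p.swap q.swap := by
  cases h with
  | bot T B C x y => exact Step.top T B C x y
  | top T B C x y => exact Step.bot T B C x y

theorem Conn.swap {p q : List α × List α} (h : Conn p q) : Conn p.swap q.swap :=
  h.lift Prod.swap (fun _ _ => Step.swap)

theorem Conn.rotate_bot (T B D : List α) (x : α) (C : List α) :
    Conn (T ++ [x], B ++ x :: (C ++ D)) (T ++ [x], B ++ x :: (D ++ C)) := by
  induction D using List.reverseRecOn generalizing C with
  | nil => simpa using ReflTransGen.refl
  | append_singleton D y ih =>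
    have h : Step (T ++ [x], B ++ x :: (C ++ (D ++ [y]))) (T ++ [x], B ++ x :: ((y :: C) ++ D)) := by
      simpa using Step.bot T B (C ++ D) x y
    simpa using ReflTransGen.head h (ih (y :: C))

theorem Conn.rotate_top (T B D : List α) (x : α) (C : List α) :
    Conn (B ++ x :: (C ++ D), T ++ [x]) (B ++ x :: (D ++ C), T ++ [x]) :=
  (Conn.rotate_bot T B D x C).swap

theorem Step.perm {p q : List α × List α} (h : Step p q) : p.1.Perm q.1 ∧ p.2.Perm q.2 := by
  have key (B C : List α) (x y : α) : (B ++ x :: (C ++ [y])).Perm (B ++ x :: y :: C) :=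
    ((List.perm_append_singleton y C).cons x).append_left B
  cases h with
  | bot T B C x y => exact ⟨.refl _, key B C x y⟩
  | top T B C x y => exact ⟨key B C x y, .refl _⟩

theorem Conn.perm {p q : List α × List α} (h : Conn p q) : p.1.Perm q.1 ∧ p.2.Perm q.2 := by
  induction h with
  | refl => exact ⟨.refl _, .refl _⟩
  | tail _ hs ih => exact ⟨ih.1.trans hs.perm.1, ih.2.trans hs.perm.2⟩

/-! ### Irreducible arrays and standard arrays -/

/-- A two-line array is irreducible if no proper initial segments of its lines have the same
letters. -/
def Irred (p : List α × List α) : Prop :=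
  ∀ U V X Y : List α, p.1 = U ++ V → p.2 = X ++ Y → U ≠ [] → V ≠ [] → ¬ U.Perm X

theorem Irred.swap {p : List α × List α} (hp : p.1.Perm p.2) (h : Irred p) : Irred p.swap := by
  intro U V X Y hU hX hU0 hV0 hUX
  simp only [Prod.fst_swap, Prod.snd_swap] at hU hX
  refine h X Y U V hX hU ?_ ?_ hUX.symm
  · rintro rfl
    exact hU0 hUX.eq_nil
  · rintro rfl
    have h1 := hp.length_eq
    have h2 := hUX.length_eq
    rw [hU, hX] at h1
    simp only [List.append_nil, List.length_append] at h1
    exact hV0 (List.length_eq_zero_iff.1 (by omega))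

theorem irred_bot (T B C C' : List α) (x : α) (hT : (T ++ [x]).Nodup)
    (h : Irred (T ++ [x], B ++ x :: C)) : Irred (T ++ [x], B ++ x :: C') := by
  intro U V X Y hU hX hU0 hV0 hUX
  simp only at hU hX
  have hxU : x ∉ U := by
    intro hx
    obtain ⟨V, v, rfl⟩ := List.eq_nil_or_concat V |>.resolve_left hV0
    rw [List.concat_eq_append, ← List.append_assoc] at hU
    obtain ⟨h1, h2⟩ := List.append_inj' hU rfl
    rw [h1, List.nodup_append] at hT
    exact hT.2.2 x (by simp [hx]) x (by simp) rfl
  have hxX : x ∉ X := fun hx => hxU (hUX.mem_iff.2 hx)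
  rcases List.append_eq_append_iff.1 hX with ⟨Z, hZ, -⟩ | ⟨Z, hZ, -⟩
  · cases Z with
    | nil => exact h U V X (x :: C) hU (by simp_all) hU0 hV0 hUX
    | cons z Z =>
      have : z = x := by simp_all
      exact hxX (by simp [hZ, this])
  · exact h U V X (Z ++ x :: C) hU (by simp [hZ]) hU0 hV0 hUX

theorem Step.irred {p q : List α × List α} (hs : Step p q) (hn : p.1.Nodup) (hp : p.1.Perm p.2)
    (h : Irred p) : Irred q := by
  cases hs with
  | bot T B C x y => exact irred_bot T B _ _ x hn h
  | top T B C x y =>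
    have h' := irred_bot T B _ (y :: C) x (hp.nodup_iff.1 hn) (Irred.swap hp h)
    refine Irred.swap ?_ h'
    exact hp.symm.trans (Step.top T B C x y).perm.1

theorem Conn.irred {p q : List α × List α} (hs : Conn p q) (hn : p.1.Nodup) (hp : p.1.Perm p.2)
    (h : Irred p) : Irred q := by
  induction hs with
  | refl => exact h
  | tail hc hs ih =>
    have hc' := Conn.perm hc
    exact hs.irred (hc'.1.nodup_iff.1 hn) (hc'.1.symm.trans (hp.trans hc'.2)) ih

/-- Either the letters satisfying `P` form an initial segment, or one of them comes after
a letter not satisfying `P`. -/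
theorem exists_split_or_forall (P : α → Prop) (L : List α) :
    (∃ U y V, L = U ++ y :: V ∧ ¬ P y ∧ ∃ x ∈ V, P x) ∨
      ∃ U V, L = U ++ V ∧ (∀ x ∈ U, P x) ∧ ∀ x ∈ V, ¬ P x := by
  induction L with
  | nil => exact .inr ⟨[], [], by simp⟩
  | cons a L ih =>
    by_cases ha : P a
    · rcases ih with ⟨U, y, V, rfl, hy, hx⟩ | ⟨U, V, rfl, hU, hV⟩
      · exact .inl ⟨a :: U, y, V, rfl, hy, hx⟩
      · exact .inr ⟨a :: U, V, rfl, by simpa [ha] using hU, hV⟩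
    · by_cases hL : ∃ x ∈ L, P x
      · exact .inl ⟨[], a, L, rfl, ha, hL⟩
      · push Not at hL
        exact .inr ⟨[], a :: L, rfl, by simp, by simpa [ha] using hL⟩

theorem exists_conn_standard (T X Y : List α) (x : α) (hT : T ≠ []) (hn : (T ++ [x]).Nodup)
    (hp : (T ++ [x]).Perm (X ++ x :: Y)) (h : Irred (T ++ [x], X ++ x :: Y)) :
    ∃ e A f B, Conn (T ++ [x], X ++ x :: Y) (e :: (A ++ [f]), f :: (B ++ [e])) := by
  induction hX : X.length using Nat.strong_induction_on generalizing T X Y x with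
  | _ k ih =>
  subst hX
  have hnB := hp.nodup_iff.1 hn
  by_cases hX0 : X = []
  · subst hX0
    obtain ⟨e, A, rfl⟩ := List.exists_cons_of_ne_nil hT
    have he : e ∈ Y := by
      have h1 : e ∈ [] ++ x :: Y := hp.mem_iff.1 (by simp)
      have h2 : e ≠ x := by
        rintro rfl
        simp at hn
      simpa [h2] using h1
    obtain ⟨Y₁, Y₂, rfl⟩ := List.append_of_mem he
    refine ⟨e, A, x, Y₂ ++ Y₁, ?_⟩
    simpa using Conn.rotate_bot (e :: A) [] Y₂ x (Y₁ ++ [e])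
  · rcases exists_split_or_forall (· ∈ X) (T ++ [x]) with
      ⟨U, y, V, hU, hy, z, hzV, hzX⟩ | ⟨U, V, hU, hUX, hVX⟩
    · have hV : V ≠ [] := List.ne_nil_of_mem hzV
      have hyx : y ≠ x := by
        rintro rfl
        obtain ⟨V, v, rfl⟩ := List.eq_nil_or_concat V |>.resolve_left hV
        rw [List.concat_eq_append, ← List.cons_append, ← List.append_assoc] at hU
        obtain ⟨h1, h2⟩ := List.append_inj' hU rfl
        rw [h1, List.nodup_append] at hn
        exact hn.2.2 y (by simp) y (by simp) rfl
      have hyY : y ∈ Y := by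
        have : y ∈ X ++ x :: Y := hp.mem_iff.1 (by simp [hU])
        simpa [hy, hyx] using this
      obtain ⟨Y₁, Y₂, rfl⟩ := List.append_of_mem hyY
      obtain ⟨V₁, V₂, rfl⟩ := List.append_of_mem hzV
      obtain ⟨X₁, X₂, rfl⟩ := List.append_of_mem hzX
      have c1 := Conn.rotate_bot T (X₁ ++ z :: X₂) Y₂ x (Y₁ ++ [y])
      have c2 := Conn.rotate_top (X₁ ++ z :: X₂ ++ x :: (Y₂ ++ Y₁)) U V₂ y (V₁ ++ [z])
      have c : Conn (T ++ [x], X₁ ++ z :: X₂ ++ x :: (Y₁ ++ y :: Y₂))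
          ((U ++ y :: (V₂ ++ V₁)) ++ [z], X₁ ++ z :: (X₂ ++ x :: (Y₂ ++ Y₁ ++ [y]))) := by
        rw [hU] at c1 ⊢
        refine ReflTransGen.trans (b := (U ++ y :: (V₁ ++ z :: V₂),
          X₁ ++ z :: X₂ ++ x :: (Y₂ ++ (Y₁ ++ [y])))) ?_ ?_
        · simpa using c1
        · simpa using c2
      have hc := Conn.perm c
      obtain ⟨e, A, f, B, h'⟩ := ih X₁.length (by simp) _ X₁ _ z (by simp) (hc.1.nodup_iff.1 hn)
        (hc.1.symm.trans (hp.trans hc.2)) (Conn.irred c hn hp h) rfl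
      exact ⟨e, A, f, B, ReflTransGen.trans c h'⟩
    · exfalso
      have hUV : U.Perm X := by
        rw [List.perm_ext_iff_of_nodup]
        · intro a
          refine ⟨hUX a, fun ha => ?_⟩
          have h1 : a ∈ T ++ [x] := hp.mem_iff.2 (by simp [ha])
          rw [hU, List.mem_append] at h1
          exact h1.resolve_right fun h2 => hVX a h2 ha
        · rw [hU] at hn
          exact hn.of_append_left
        · exact hnB.of_append_left
      refine h U V X (x :: Y) hU rfl ?_ ?_ hUV
      · rintro rfl
        exact hX0 (hUV.symm.eq_nil)
      · rintro rfl
        have h1 := hUV.length_eq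
        have h2 := hp.length_eq
        rw [hU] at h2
        simp at h2
        omega

/-! ### Block moves on the interior of a standard array -/

/-- The block move: given two letters in the same order in both lines, exchange the blocks ending
with these letters. -/
inductive Move : List α × List α → List α × List α → Prop
  | mk (A B E C D F : List α) (z w : α) :
      Move (A ++ z :: (B ++ w :: E), C ++ z :: (D ++ w :: F))
        (B ++ w :: (A ++ z :: E), D ++ w :: (C ++ z :: F))

theorem Move.conn {p q : List α × List α} (h : Move p q) (e f : α) :
    Conn (e :: (p.1 ++ [f]), f :: (p.2 ++ [e])) (e :: (q.1 ++ [f]), f :: (q.2 ++ [e])) := by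
  obtain ⟨A, B, E, C, D, F, z, w⟩ := h
  have c1 := Conn.rotate_bot (e :: A ++ z :: (B ++ w :: E)) [] (D ++ w :: (F ++ [e])) f (C ++ [z])
  have c2 := Conn.rotate_top (f :: D ++ w :: (F ++ e :: C)) (e :: A) (E ++ [f]) z (B ++ [w])
  have c3 := Conn.rotate_bot (e :: A ++ z :: (E ++ f :: B)) (f :: D) (C ++ [z]) w (F ++ [e])
  have c4 := Conn.rotate_top (f :: D ++ w :: (C ++ z :: F)) [] (B ++ [w]) e (A ++ z :: (E ++ [f]))
  simp only [List.append_assoc, List.cons_append, List.nil_append] at c1 c2 c3 c4 ⊢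
  exact c1.trans (c2.trans (c3.trans c4))

theorem Move.append {p q : List α × List α} (h : Move p q) (K K' : List α) :
    Move (p.1 ++ K, p.2 ++ K') (q.1 ++ K, q.2 ++ K') := by
  obtain ⟨A, B, E, C, D, F, z, w⟩ := h
  simpa using Move.mk A B (E ++ K) C D (F ++ K') z w

theorem Move.perm {p q : List α × List α} (h : Move p q) : p.1.Perm q.1 ∧ p.2.Perm q.2 := by
  have key (A B E : List α) (z w : α) :
      (A ++ z :: (B ++ w :: E)).Perm (B ++ w :: (A ++ z :: E)) := by
    have : ((A ++ [z]) ++ (B ++ [w]) ++ E).Perm ((B ++ [w]) ++ (A ++ [z]) ++ E) :=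
      List.perm_append_comm.append_right E
    simpa using this
  obtain ⟨A, B, E, C, D, F, z, w⟩ := h
  exact ⟨key A B E z w, key C D F z w⟩

/-- The correspondence between the letters of the two lines at equal positions is symmetric. -/
def Symm (p : List α × List α) : Prop :=
  p.1.length = p.2.length ∧ ∀ x y, (x, y) ∈ p.1.zip p.2 → (y, x) ∈ p.1.zip p.2

theorem Symm.append {T B K K' : List α} (h : Symm (T, B)) (hK : Symm (K, K')) :
    Symm (T ++ K, B ++ K') := by
  refine ⟨by simpa using congrArg₂ (· + ·) h.1 hK.1, fun x y hxy => ?_⟩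
  simp only at hxy ⊢
  rw [List.zip_append h.1, List.mem_append] at hxy ⊢
  exact hxy.imp (h.2 x y) (hK.2 x y)

theorem symm_reverse (L : List α) : Symm (L, L.reverse) := by
  refine ⟨by simp, fun x y hxy => ?_⟩
  simp only [List.mem_iff_getElem, List.getElem_zip, List.length_zip, List.length_reverse,
    min_self, List.getElem_reverse, Prod.mk.injEq] at hxy ⊢
  obtain ⟨i, hi, rfl, rfl⟩ := hxy
  exact ⟨L.length - 1 - i, by omega, rfl, by congr 1; omega⟩

theorem Symm.standard {T B : List α} (h : Symm (T, B)) (e f : α) :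
    Symm (e :: (T ++ [f]), f :: (B ++ [e])) := by
  refine ⟨by simpa using h.1, fun x y hxy => ?_⟩
  have h1 : T.length = B.length := h.1
  simp only [List.zip_cons_cons, List.zip_append h1, List.mem_cons, List.mem_append,
    Prod.mk.injEq, List.zip_nil_right, List.not_mem_nil, or_false] at hxy ⊢
  have := h.2 x y
  simp only at this
  tauto

theorem exists_pair_of_ne_reverse (L L' : List α) (hn : L.Nodup) (hp : L.Perm L')
    (h : L' ≠ L.reverse) :
    ∃ y w, [y, w].Sublist L ∧ [y, w].Sublist L' := by
  induction L generalizing L' with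
  | nil => exact absurd hp.symm.eq_nil (by simpa using h)
  | cons x L ih =>
    obtain ⟨C, D, rfl⟩ := List.append_of_mem (hp.mem_iff.1 (List.mem_cons_self))
    have hp' : L.Perm (C ++ D) := (hp.trans List.perm_middle).cons_inv
    cases D with
    | nil =>
      have hp'' : L.Perm C := by simpa using hp'
      obtain ⟨y, w, h1, h2⟩ := ih C (List.nodup_cons.1 hn).2 hp'' (by rintro rfl; simp at h)
      exact ⟨y, w, h1.cons x, h2.trans (List.sublist_append_left _ _)⟩
    | cons w D =>
      refine ⟨x, w, ?_, ?_⟩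
      · exact (List.singleton_sublist.2 (hp'.mem_iff.2 (by simp))).cons_cons x
      · exact (((List.nil_sublist D).cons_cons w).cons_cons x).trans (List.sublist_append_right _ _)

theorem exists_split_of_pair_sublist {L : List α} {y w : α} (h : [y, w].Sublist L) :
    ∃ A B E, L = A ++ y :: (B ++ w :: E) := by
  obtain ⟨r₁, r₂, rfl, h1, h2⟩ := List.cons_sublist_iff.1 h
  obtain ⟨A, B, rfl⟩ := List.append_of_mem h1
  obtain ⟨B', E, rfl⟩ := List.append_of_mem (List.singleton_sublist.1 h2)
  exact ⟨A, B ++ B', E, by simp⟩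

theorem exists_maximal_prefix (P : α → Prop) (L : List α) :
    ∃ U V, L = U ++ V ∧ (∀ x ∈ U, P x) ∧ (V = [] ∨ ∃ y D, V = y :: D ∧ ¬ P y) := by
  induction L with
  | nil => exact ⟨[], [], by simp⟩
  | cons a L ih =>
    by_cases ha : P a
    · obtain ⟨U, V, rfl, hU, hV⟩ := ih
      exact ⟨a :: U, V, rfl, by simpa [ha] using hU, hV⟩
    · exact ⟨[], a :: L, rfl, by simp, .inr ⟨a, L, rfl, ha⟩⟩

/-- A list is a run of letters outside `P`, a run of letters in `P` and a remainder that does not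
begin in `P`. -/
theorem exists_runs (P : α → Prop) (L : List α) :
    ∃ N R S, L = N ++ (R ++ S) ∧ (∀ x ∈ N, ¬ P x) ∧ (∀ x ∈ R, P x) ∧
      (S = [] ∨ ∃ y D, S = y :: D ∧ ¬ P y ∧ R ≠ []) := by
  obtain ⟨N, V, rfl, hN, hV⟩ := exists_maximal_prefix (¬ P ·) L
  obtain ⟨R, S, rfl, hR, hS⟩ := exists_maximal_prefix P V
  refine ⟨N, R, S, rfl, hN, hR, hS.imp_right ?_⟩
  rintro ⟨y, D, rfl, hy⟩
  refine ⟨y, D, rfl, hy, ?_⟩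
  rintro rfl
  simp_all

theorem exists_move_symm (T B : List α) (hn : T.Nodup) (hp : T.Perm B) :
    ∃ q, ReflTransGen Move (T, B) q ∧ Symm q := by
  induction hk : T.length using Nat.strong_induction_on generalizing T B with
  | _ k ihk =>
  rcases List.eq_nil_or_concat B with rfl | ⟨B, j, rfl⟩
  · obtain rfl := hp.eq_nil
    exact ⟨_, .refl, symm_reverse []⟩
  rw [List.concat_eq_append] at hp ⊢
  obtain ⟨T, R, rfl⟩ := List.append_of_mem (hp.mem_iff.2 (show j ∈ B ++ [j] by simp))
  -- peel off a reversed block at the right end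
  have block (T B R : List α) (j : α) (hn : (T ++ j :: R).Nodup)
      (hp : (T ++ j :: R).Perm (B ++ (R.reverse ++ [j]))) (hk : (T ++ j :: R).length = k) :
      ∃ q, ReflTransGen Move (T ++ j :: R, B ++ (R.reverse ++ [j])) q ∧ Symm q := by
    have hp' : T.Perm B := by
      have h1 : (T ++ j :: R).Perm (B ++ j :: R) :=
        hp.trans (List.Perm.append_left B (by simpa using List.reverse_perm (j :: R)))
      exact (List.perm_append_right_iff _).1 h1
    obtain ⟨q, hq, hs⟩ := ihk T.length (by simp at hk; omega) T B hn.of_append_left hp' rfl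
    refine ⟨(q.1 ++ j :: R, q.2 ++ (R.reverse ++ [j])), ?_, ?_⟩
    · exact hq.lift (fun p => (p.1 ++ j :: R, p.2 ++ (R.reverse ++ [j])))
        (fun _ _ h => h.append _ _)
    · have := symm_reverse (j :: R)
      rw [List.reverse_cons] at this
      exact Symm.append hs this
  induction hd : R.length using Nat.strong_induction_on generalizing T B R j with
  | _ d ihd =>
  have pair (T B R : List α) (j y w : α) (hn : (T ++ j :: R).Nodup)
      (hp : (T ++ j :: R).Perm (B ++ [j])) (hk : (T ++ j :: R).length = k) (hd : R.length = d)
      (h1 : [y, w].Sublist R) (h2 : [y, w].Sublist B) :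
      ∃ q, ReflTransGen Move (T ++ j :: R, B ++ [j]) q ∧ Symm q := by
    obtain ⟨A, M, E, rfl⟩ := exists_split_of_pair_sublist h1
    obtain ⟨C, D, F, rfl⟩ := exists_split_of_pair_sublist h2
    have hm : Move (T ++ j :: (A ++ y :: (M ++ w :: E)), C ++ y :: (D ++ w :: F) ++ [j])
        ((M ++ w :: T) ++ j :: (A ++ y :: E), (D ++ w :: (C ++ y :: F)) ++ [j]) := by
      simpa using Move.mk (T ++ j :: A) M E C D (F ++ [j]) y w
    have hmp := hm.perm
    obtain ⟨q, hq, hs⟩ := ihd (A ++ y :: E).length (by simp at hd ⊢; omega)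
      (D ++ w :: (C ++ y :: F)) j (M ++ w :: T) (A ++ y :: E)
      (hmp.1.nodup_iff.1 hn) (hmp.1.length_eq.symm.trans hk) (hmp.1.symm.trans (hp.trans hmp.2)) rfl
    exact ⟨q, .head hm hq, hs⟩
  have hnB := hp.nodup_iff.1 hn
  have hRB : ∀ x ∈ R, x ∈ B := by
    intro x hx
    have h1 : x ∈ B ++ [j] := hp.mem_iff.1 (by simp [hx])
    have h2 : x ≠ j := by
      rintro rfl
      simp [List.nodup_append, hx] at hn
    simpa [h2] using h1
  have hnR : R.Nodup := (List.nodup_cons.1 hn.of_append_right).2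
  obtain ⟨N, Q, S, rfl, hN, hQ, hS⟩ := exists_runs (· ∈ R) B
  have hnQ : Q.Nodup := hnB.of_append_left.of_append_right.of_append_left
  by_cases hSR : ∃ h ∈ S, h ∈ R
  · obtain ⟨h, hhS, hhR⟩ := hSR
    rcases hS with rfl | ⟨y, D, rfl, hyR, hQ0⟩
    · simp at hhS
    obtain ⟨g, hg⟩ := List.exists_mem_of_ne_nil Q hQ0
    have hgR := hQ g hg
    have hgh : g ≠ h := by
      rintro rfl
      have := hnB.of_append_left.of_append_right
      rw [List.nodup_append] at this
      exact this.2.2 g hg g hhS rfl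
    have hB : [g, h].Sublist (N ++ (Q ++ y :: D)) :=
      ((List.singleton_sublist.2 hg).append (List.singleton_sublist.2 hhS)).trans
        (List.sublist_append_right _ _)
    obtain ⟨R₁, R₂, rfl⟩ := List.append_of_mem hgR
    rcases List.mem_append.1 hhR with hh1 | hh2
    · have hhD : h ∈ D := by
        have : h ≠ y := by
          rintro rfl
          exact hyR hhR
        simpa [this] using hhS
      have hyT : y ∈ T := by
        have h1 : y ∈ T ++ j :: (R₁ ++ g :: R₂) := hp.mem_iff.2 (by simp)
        have h2 : y ≠ j := by
          rintro rfl
          simp [List.nodup_append] at hnB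
        rw [List.mem_append, List.mem_cons] at h1
        exact h1.resolve_right (by simp only [not_or]; exact ⟨h2, hyR⟩)
      obtain ⟨A, M, rfl⟩ := List.append_of_mem hyT
      have hm : Move (A ++ y :: M ++ j :: (R₁ ++ g :: R₂), N ++ (Q ++ y :: D) ++ [j])
          ((M ++ j :: A) ++ y :: (R₁ ++ g :: R₂), (D ++ j :: (N ++ Q)) ++ [y]) := by
        simpa using Move.mk A M (R₁ ++ g :: R₂) (N ++ Q) D [] y j
      have hmp := hm.perm
      obtain ⟨q, hq, hs⟩ := pair (M ++ j :: A) (D ++ j :: (N ++ Q)) (R₁ ++ g :: R₂) y h g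
        (hmp.1.nodup_iff.1 hn) (hmp.1.symm.trans (hp.trans hmp.2))
        (hmp.1.length_eq.symm.trans hk) hd
        ((List.singleton_sublist.2 hh1).append (List.singleton_sublist.2 (by simp)))
        ((List.singleton_sublist.2 hhD).append (List.singleton_sublist.2 (by simp [hg])))
      exact ⟨q, .head hm hq, hs⟩
    · have hh3 : h ∈ R₂ := by simpa [hgh.symm] using hh2
      exact pair T _ _ j g h hn hp hk hd
        (((List.singleton_sublist.2 hh3).cons_cons g).trans (List.sublist_append_right _ _)) hB
  · push Not at hSR
    have hQR : R.Perm Q := by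
      rw [List.perm_ext_iff_of_nodup hnR hnQ]
      refine fun a => ⟨fun ha => ?_, hQ a⟩
      have := hRB a ha
      rw [List.mem_append, List.mem_append] at this
      rcases this with h1 | h1 | h1
      · exact absurd ha (hN a h1)
      · exact h1
      · exact absurd ha (hSR a h1)
    by_cases hrev : Q = R.reverse
    · subst hrev
      rcases hS with rfl | ⟨y, D, rfl, hyR, -⟩
      · simpa using block T N R j hn (by simpa using hp) hk
      · have hyT : y ∈ T := by
          have h1 : y ∈ T ++ j :: R := hp.mem_iff.2 (by simp)
          have h2 : y ≠ j := by
            rintro rfl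
            simp [List.nodup_append] at hnB
          simpa [h2, hyR] using h1
        obtain ⟨A, M, rfl⟩ := List.append_of_mem hyT
        have hm : Move (A ++ y :: M ++ j :: R, N ++ (R.reverse ++ y :: D) ++ [j])
            ((M ++ j :: A) ++ y :: R, (D ++ j :: N) ++ (R.reverse ++ [y])) := by
          simpa using Move.mk A M R (N ++ R.reverse) D [] y j
        have hmp := hm.perm
        obtain ⟨q, hq, hs⟩ := block (M ++ j :: A) (D ++ j :: N) R y
          (hmp.1.nodup_iff.1 hn) (hmp.1.symm.trans (hp.trans hmp.2))
          (hmp.1.length_eq.symm.trans hk)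
        exact ⟨q, .head hm hq, hs⟩
    · obtain ⟨y, w, h1, h2⟩ := exists_pair_of_ne_reverse R Q hnR hQR hrev
      exact pair T _ R j y w hn hp hk hd h1
        (h2.trans ((List.sublist_append_left _ _).trans (List.sublist_append_right _ _)))

theorem exists_conn_symm (p : List α × List α) (hl : 2 ≤ p.1.length) (hn : p.1.Nodup)
    (hp : p.1.Perm p.2) (h : Irred p) : ∃ q, Conn p q ∧ Symm q := by
  obtain ⟨T, B⟩ := p
  simp only at hl hn hp
  rcases List.eq_nil_or_concat T with rfl | ⟨T, x, rfl⟩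
  · simp at hl
  rw [List.concat_eq_append] at *
  obtain ⟨X, Y, rfl⟩ := List.append_of_mem (hp.mem_iff.1 (show x ∈ T ++ [x] by simp))
  obtain ⟨e, A, f, B, hc⟩ := exists_conn_standard T X Y x (by rintro rfl; simp at hl) hn hp h
  have hcp := Conn.perm hc
  have hAB : A.Perm B := by
    have h1 : (e :: (A ++ [f])).Perm (f :: (B ++ [e])) := hcp.1.symm.trans (hp.trans hcp.2)
    have h2 : (A ++ [f, e]).Perm (B ++ [f, e]) := by
      refine List.Perm.trans ?_ (h1.trans ?_)
      · simpa using List.perm_append_singleton e (A ++ [f])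
      · exact List.perm_middle.symm
    exact (List.perm_append_right_iff _).1 h2
  have hnA : A.Nodup := by
    have := hcp.1.nodup_iff.1 hn
    exact (List.nodup_cons.1 this).2.of_append_left
  obtain ⟨q, hq, hs⟩ := exists_move_symm A B hnA hAB
  refine ⟨_, hc.trans ?_, Symm.standard hs e f⟩
  clear hs
  induction hq with
  | refl => exact .refl
  | tail _ hm ih => exact ih.trans (hm.conn e f)

/-! ### Two-line arrays of permutations -/

section Represents

variable {n : ℕ}

/-- The two-line array `p` represents the permutation `π`. -/
structure Represents (π : Equiv.Perm (Fin n)) (p : List α × List α) : Prop where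
  nodup_top : p.1.Nodup
  nodup_bot : p.2.Nodup
  length_top : p.1.length = n
  length_bot : p.2.length = n
  getElem?_eq : ∀ i : Fin n, p.2[(π i).val]? = p.1[i.val]?

theorem represents_finRange (π : Equiv.Perm (Fin n)) :
    Represents π (List.finRange n, (List.finRange n).map π.symm) where
  nodup_top := List.nodup_finRange n
  nodup_bot := (List.nodup_finRange n).map π.symm.injective
  length_top := by simp
  length_bot := by simp
  getElem?_eq i := by simp

theorem Represents.swap {π : Equiv.Perm (Fin n)} {p : List α × List α} (h : Represents π p) :
    Represents π⁻¹ p.swap where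
  nodup_top := h.nodup_bot
  nodup_bot := h.nodup_top
  length_top := h.length_bot
  length_bot := h.length_top
  getElem?_eq i := by simpa using (h.getElem?_eq (π⁻¹ i)).symm

theorem rauzyQ_val (m k : Fin n) :
    (rauzyQ m k).val =
      if k.val ≤ m.val then k.val else if k.val = n - 1 then m.val + 1 else k.val + 1 := by
  have hk := k.isLt
  have hm := m.isLt
  have : NeZero n := ⟨by omega⟩
  have hlt : (if k.val ≤ m.val then k.val
      else if k.val = n - 1 then m.val + 1 else k.val + 1) < n := by
    split_ifs <;> omega
  obtain ⟨v, hv⟩ : ∃ v : Fin n, v.val =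
      if k.val ≤ m.val then k.val else if k.val = n - 1 then m.val + 1 else k.val + 1 :=
    ⟨⟨_, hlt⟩, rfl⟩
  rw [← hv]
  congr 1
  rw [rauzyQ, Equiv.Perm.inv_eq_iff_eq]
  ext
  simp only [Equiv.Perm.coe_mul, Function.comp_apply, Fin.revPerm_apply, Fin.val_rev]
  set i : Fin n := ⟨n - 2 - m.val, by omega⟩ with hi
  rcases lt_or_ge i v.rev with h | h
  · rw [Fin.cycleRange_of_gt h, Fin.val_rev]
    rw [Fin.lt_def, Fin.val_rev] at h
    simp only [hi] at h
    split_ifs at hv <;> omega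
  · rw [Fin.coe_cycleRange_of_le h]
    rw [Fin.le_def, Fin.val_rev] at h
    simp only [hi, Fin.ext_iff, Fin.val_rev] at h ⊢
    split_ifs at hv ⊢ <;> omega

theorem getElem?_rauzyQ (m k : Fin n) (B C : List α) (x y : α) (hm : m.val = B.length)
    (hn : (B ++ x :: (C ++ [y])).length = n) :
    (B ++ x :: y :: C)[(rauzyQ m k).val]? = (B ++ x :: (C ++ [y]))[k.val]? := by
  have hk := k.isLt
  simp only [List.length_append, List.length_cons, List.length_nil] at hn
  rw [rauzyQ_val, hm]
  split_ifs with h1 h2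
  · rcases h1.lt_or_eq with h | h
    · rw [List.getElem?_append_left h, List.getElem?_append_left h]
    · simp [h]
  · have h3 : k.val = B.length + (1 + C.length) := by omega
    rw [h3, List.getElem?_append_right (by omega), List.getElem?_append_right (by omega)]
    simp [Nat.add_comm 1]
  · obtain ⟨d, hd⟩ : ∃ d, k.val = B.length + (d + 1) := ⟨k.val - B.length - 1, by omega⟩
    rw [hd, List.getElem?_append_right (by omega), List.getElem?_append_right (by omega)]
    have e1 : B.length + (d + 1) + 1 - B.length = d + 2 := by omega
    have e2 : B.length + (d + 1) - B.length = d + 1 := by omega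
    rw [e1, e2]
    simp only [List.getElem?_cons_succ]
    rw [List.getElem?_append_left (by omega)]

theorem Represents.rauzyA {π : Equiv.Perm (Fin n)} {T B C : List α} {x y : α}
    (h : Represents π (T ++ [x], B ++ x :: (C ++ [y]))) :
    Represents (rauzyA π) (T ++ [x], B ++ x :: y :: C) := by
  have hs := (Step.bot T B C x y).perm.2
  simp only at hs
  have hT : T.length + 1 = n := by simpa using h.length_top
  have hlast : (π ⟨n - 1, by omega⟩).val = B.length := by
    refine (List.getElem?_inj (h.length_bot.symm ▸ Fin.isLt _) h.nodup_bot).1 ?_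
    rw [h.getElem?_eq]
    simp [← hT]
  refine ⟨h.nodup_top, hs.nodup_iff.1 h.nodup_bot, h.length_top,
    hs.length_eq.symm.trans h.length_bot, fun i => ?_⟩
  rw [_root_.rauzyA, dif_neg (by omega), Equiv.Perm.mul_apply]
  exact (getElem?_rauzyQ _ _ B C x y hlast h.length_bot).trans (h.getElem?_eq i)

theorem rauzyB_eq (π : Equiv.Perm (Fin n)) : rauzyB π = (rauzyA π⁻¹)⁻¹ := by
  unfold rauzyA rauzyB
  split <;> simp

theorem rauzyA_inv (π : Equiv.Perm (Fin n)) : rauzyA π⁻¹ = (rauzyB π)⁻¹ := by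
  rw [rauzyB_eq, inv_inv]

theorem rauzyB_inv (π : Equiv.Perm (Fin n)) : rauzyB π⁻¹ = (rauzyA π)⁻¹ := by
  rw [rauzyB_eq, inv_inv]

theorem revPerm_mul_self : (Fin.revPerm * Fin.revPerm : Equiv.Perm (Fin n)) = 1 := by
  ext i
  simp

theorem rauzyC_inv (π : Equiv.Perm (Fin n)) : rauzyC π⁻¹ = (rauzyC π)⁻¹ := by
  have h : (Fin.revPerm : Equiv.Perm (Fin n))⁻¹ = Fin.revPerm :=
    inv_eq_of_mul_eq_one_left revPerm_mul_self
  simp [rauzyC, h, mul_assoc]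

theorem rauzyC_rauzyC (π : Equiv.Perm (Fin n)) : rauzyC (rauzyC π) = π := by
  have h : (Fin.revPerm : Equiv.Perm (Fin n))⁻¹ = Fin.revPerm :=
    inv_eq_of_mul_eq_one_left revPerm_mul_self
  rw [rauzyC, rauzyC]
  simp only [mul_inv_rev, inv_inv, h]
  simp only [mul_assoc, revPerm_mul_self, mul_one]
  rw [← mul_assoc, revPerm_mul_self, one_mul]

theorem mem_rauzyClassEx_self (π : Equiv.Perm (Fin n)) : π ∈ RauzyClassEx π :=
  fun _ h _ _ _ => h

theorem rauzyA_mem {π σ : Equiv.Perm (Fin n)} (h : σ ∈ RauzyClassEx π) :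
    rauzyA σ ∈ RauzyClassEx π :=
  fun S hS ha hb hc => ha _ (h S hS ha hb hc)

theorem rauzyB_mem {π σ : Equiv.Perm (Fin n)} (h : σ ∈ RauzyClassEx π) :
    rauzyB σ ∈ RauzyClassEx π :=
  fun S hS ha hb hc => hb _ (h S hS ha hb hc)

theorem rauzyC_mem {π σ : Equiv.Perm (Fin n)} (h : σ ∈ RauzyClassEx π) :
    rauzyC σ ∈ RauzyClassEx π :=
  fun S hS ha hb hc => hc _ (h S hS ha hb hc)

theorem rauzyClassEx_trans {π σ τ : Equiv.Perm (Fin n)} (h : σ ∈ RauzyClassEx π)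
    (h' : τ ∈ RauzyClassEx σ) : τ ∈ RauzyClassEx π :=
  h' _ h (fun _ => rauzyA_mem) (fun _ => rauzyB_mem) (fun _ => rauzyC_mem)

theorem inv_mem_rauzyClassEx {π σ : Equiv.Perm (Fin n)} (h : σ ∈ RauzyClassEx π) :
    σ⁻¹ ∈ RauzyClassEx π⁻¹ := by
  refine h {τ | τ⁻¹ ∈ RauzyClassEx π⁻¹} (mem_rauzyClassEx_self _) ?_ ?_ ?_
  · intro τ hτ
    rw [Set.mem_ofPred_eq, ← rauzyB_inv]
    exact rauzyB_mem hτ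
  · intro τ hτ
    rw [Set.mem_ofPred_eq, ← rauzyA_inv]
    exact rauzyA_mem hτ
  · intro τ hτ
    rw [Set.mem_ofPred_eq, ← rauzyC_inv]
    exact rauzyC_mem hτ

theorem mem_rauzyClassEx_rauzyA (π : Equiv.Perm (Fin n)) : π ∈ RauzyClassEx (rauzyA π) := by
  rcases Nat.eq_zero_or_pos n with h0 | h0
  · rw [rauzyA, dif_pos h0]
    exact mem_rauzyClassEx_self π
  set l : Fin n := ⟨n - 1, by omega⟩
  have hq : rauzyQ (π l) (π l) = π l := by
    ext
    simp [rauzyQ_val]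
  have ha (σ : Equiv.Perm (Fin n)) : rauzyA σ = rauzyQ (σ l) * σ := by
    rw [rauzyA, dif_neg h0.ne']
  have key (k : ℕ) : rauzyQ (π l) ^ (k + 1) * π ∈ RauzyClassEx (rauzyA π) := by
    induction k with
    | zero => simpa [ha] using mem_rauzyClassEx_self (rauzyA π)
    | succ k ih =>
      have h := rauzyA_mem ih
      have hk : (rauzyQ (π l) ^ (k + 1) * π) l = π l := by
        rw [Equiv.Perm.mul_apply]
        exact Equiv.Perm.pow_apply_eq_self_of_apply_eq_self hq (k + 1)
      rwa [ha (_ * _), hk, ← mul_assoc, ← pow_succ'] at h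
  have h := key (orderOf (rauzyQ (π l)) - 1)
  rwa [Nat.sub_add_cancel (orderOf_pos _), pow_orderOf_eq_one, one_mul] at h

theorem mem_rauzyClassEx_rauzyB (π : Equiv.Perm (Fin n)) : π ∈ RauzyClassEx (rauzyB π) := by
  have h := inv_mem_rauzyClassEx (mem_rauzyClassEx_rauzyA π⁻¹)
  rwa [inv_inv, ← rauzyB_eq] at h

theorem mem_rauzyClassEx_rauzyC (π : Equiv.Perm (Fin n)) : π ∈ RauzyClassEx (rauzyC π) := by
  have h := rauzyC_mem (mem_rauzyClassEx_self (rauzyC π))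
  rwa [rauzyC_rauzyC] at h

theorem rauzyClassEx_symm {π σ : Equiv.Perm (Fin n)} (h : σ ∈ RauzyClassEx π) :
    π ∈ RauzyClassEx σ :=
  h {τ | π ∈ RauzyClassEx τ} (mem_rauzyClassEx_self π)
    (fun τ hτ => rauzyClassEx_trans (mem_rauzyClassEx_rauzyA τ) hτ)
    (fun τ hτ => rauzyClassEx_trans (mem_rauzyClassEx_rauzyB τ) hτ)
    (fun τ hτ => rauzyClassEx_trans (mem_rauzyClassEx_rauzyC τ) hτ)

theorem Conn.represents {π : Equiv.Perm (Fin n)} {p q : List α × List α} (h : Conn p q)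
    (hp : Represents π p) : ∃ σ ∈ RauzyClassEx π, Represents σ q := by
  induction h with
  | refl => exact ⟨π, mem_rauzyClassEx_self π, hp⟩
  | tail _ hs ih =>
    obtain ⟨σ, hσ, hr⟩ := ih
    cases hs with
    | bot T B C x y => exact ⟨_, rauzyA_mem hσ, hr.rauzyA⟩
    | top T B C x y =>
      refine ⟨_, rauzyB_mem hσ, ?_⟩
      rw [rauzyB_eq]
      exact (Represents.rauzyA hr.swap).swap

theorem IrreduciblePerm.irred {π : Equiv.Perm (Fin n)} {p : List α × List α}
    (h : IrreduciblePerm π) (hp : Represents π p) : Irred p := by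
  intro U V X Y hU hX hU0 hV0 hUX
  have hl : (U ++ V).length = n := hU ▸ hp.length_top
  rw [List.length_append] at hl
  have hU1 := List.length_pos_iff.2 hU0
  have hV1 := List.length_pos_iff.2 hV0
  have hXl := hUX.length_eq
  refine h (U.length - 1) (by omega) fun i hi => ?_
  have hi' : i.val < U.length := by omega
  have h1 := hp.getElem?_eq i
  rw [hU, List.getElem?_append_left hi', List.getElem?_eq_getElem hi'] at h1
  obtain ⟨j, hj, hjX⟩ := List.mem_iff_getElem.1 (hUX.mem_iff.1 (List.getElem_mem hi'))
  have h2 : p.2[j]? = some U[i.val] := by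
    rw [hX, List.getElem?_append_left hj, List.getElem?_eq_getElem hj, hjX]
  have h3 : (π i).val = j :=
    (List.getElem?_inj (hp.length_bot.symm ▸ Fin.isLt _) hp.nodup_bot).1 (h1.trans h2.symm)
  omega

theorem Symm.inv_eq {σ : Equiv.Perm (Fin n)} {p : List α × List α} (hs : Symm p)
    (hp : Represents σ p) : σ⁻¹ = σ := by
  have mem_zip (x y : α) : (x, y) ∈ p.1.zip p.2 ↔ ∃ i : ℕ, p.1[i]? = some x ∧ p.2[i]? = some y := by
    simp [List.mem_iff_getElem?, List.getElem?_zip_eq_some]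
  have h1 : p.1.length = n := hp.length_top
  have h2 : p.2.length = n := hp.length_bot
  have key (i : Fin n) : σ (σ i) = i := by
    have hi := i.isLt
    -- the letter `x` sits above position `i`, the letter `y` above position `σ i`
    obtain ⟨k, hk1, hk2⟩ := (mem_zip _ _).1 (hs.2 _ _ ((mem_zip p.1[(σ i).val] p.2[(σ i).val]).2
      ⟨(σ i).val, List.getElem?_eq_getElem _, List.getElem?_eq_getElem _⟩))
    have e1 : k = i.val := by
      refine ((List.getElem?_inj (h1.symm ▸ hi) hp.nodup_top).1 ?_).symm
      rw [hk1, ← hp.getElem?_eq i]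
      exact List.getElem?_eq_getElem _
    have e2 : (σ (σ i)).val = k := by
      refine (List.getElem?_inj (h2.symm ▸ Fin.isLt _) hp.nodup_bot).1 ?_
      rw [hk2, hp.getElem?_eq]
      exact List.getElem?_eq_getElem _
    exact Fin.ext (e2.trans e1)
  ext i
  rw [Equiv.Perm.inv_eq_iff_eq.2 (key i).symm]

theorem IrreduciblePerm.inv {π : Equiv.Perm (Fin n)} (h : IrreduciblePerm π) :
    IrreduciblePerm π⁻¹ := by
  intro k hk hm
  refine h k hk fun i hi => ?_
  set s := Finset.univ.filter fun j : Fin n => j.val ≤ k with hs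
  have h1 : s.map π⁻¹.toEmbedding = s := by
    refine Finset.map_eq_of_subset fun x hx => ?_
    obtain ⟨y, hy, rfl⟩ := Finset.mem_map.1 hx
    simp only [hs, Finset.mem_filter, Finset.mem_univ, true_and] at hy ⊢
    exact hm y hy
  have h2 : i ∈ s.map π⁻¹.toEmbedding := by
    rw [h1]
    simpa [hs] using hi
  obtain ⟨y, hy, rfl⟩ := Finset.mem_map.1 h2
  simpa [hs] using hy

end Represents

end Rauzy

/-- `π` is irreducible iff `π⁻¹` is irreducible; moreover if
`π` is irreducible then `π⁻¹` belongs to the extended Rauzy class of `π`. -/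
theorem irreduciblePerm_inv_iff_and_mem_rauzyClassEx (n : ℕ) (hn : 2 ≤ n)
    (π : Equiv.Perm (Fin n)) :
    (IrreduciblePerm π ↔ IrreduciblePerm π⁻¹) ∧
      (IrreduciblePerm π → π⁻¹ ∈ RauzyClassEx π) := by
  have hinv := @Rauzy.IrreduciblePerm.inv n
  refine ⟨⟨hinv, fun h => inv_inv π ▸ hinv h⟩, fun h => ?_⟩
  have hr := Rauzy.represents_finRange π
  obtain ⟨q, hc, hq⟩ := Rauzy.exists_conn_symm _ (by simpa using hn) hr.nodup_top
    ((List.perm_ext_iff_of_nodup hr.nodup_top hr.nodup_bot).2 fun a =>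
      ⟨fun _ => List.mem_map.2 ⟨π a, List.mem_finRange _, π.symm_apply_apply a⟩,
        fun _ => List.mem_finRange a⟩)
    (Rauzy.IrreduciblePerm.irred h hr)
  obtain ⟨σ, hσ, hσq⟩ := Rauzy.Conn.represents hc hr
  have h' := Rauzy.inv_mem_rauzyClassEx hσ
  rw [Rauzy.Symm.inv_eq hq hσq] at h'
  exact Rauzy.rauzyClassEx_trans hσ (Rauzy.rauzyClassEx_symm h')
end

section
/- Let n ≥ 2 and let π₀ be the permutation of {1,…,n} defined by π₀(i) = n+1−i. Then the Rauzy class R(π₀) has exactly 2^(n−1) − 1 elements. -/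
open Equiv

/-- The inverse of the cycle `0 ↦ 1 ↦ ⋯ ↦ p - 1 ↦ 0`. -/
def rauzyRot {n : ℕ} (p : Fin n) : Perm (Fin n) :=
  (Fin.cycleRange ⟨p - 1, by omega⟩)⁻¹

theorem rauzyRot_apply_of_le {n : ℕ} {p x : Fin n} (h : p ≤ x) (hx : x.val ≠ 0) :
    rauzyRot p x = x := by
  rw [rauzyRot, Perm.inv_eq_iff_eq, Fin.cycleRange_of_gt]
  rw [Fin.lt_def]
  rw [Fin.le_def] at h
  simp only
  omega

theorem val_rauzyRot {n : ℕ} {p x : Fin n} (h : x < p) (hx : x.val ≠ 0) :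
    (rauzyRot p x).val + 1 = x := by
  have hy : rauzyRot p x = ⟨x - 1, by omega⟩ := by
    rw [rauzyRot, Perm.inv_eq_iff_eq]
    ext
    rw [Fin.lt_def] at h
    rw [Fin.coe_cycleRange_of_lt]
    · simp only; omega
    · rw [Fin.lt_def]; simp only; omega
  rw [hy]
  simp only
  omega

theorem rauzyRot_pow_apply_self {n : ℕ} (p : Fin n) (hp : p.val ≠ 0) (j : ℕ) :
    (rauzyRot p ^ j) p = p := by
  induction j with
  | zero => rfl
  | succ j ih => rw [pow_succ', Perm.mul_apply, ih, rauzyRot_apply_of_le le_rfl hp]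

theorem val_rauzyRot_pow {n : ℕ} {p x : Fin n} (hx : x < p) (j : ℕ) (hj : j ≤ x.val) :
    ((rauzyRot p ^ j) x).val + j = x := by
  induction j with
  | zero => rfl
  | succ j ih =>
    have h := ih (by omega)
    rw [Fin.lt_def] at hx
    have h' := val_rauzyRot (p := p) (x := (rauzyRot p ^ j) x)
      (by rw [Fin.lt_def]; omega) (by omega)
    rw [pow_succ', Perm.mul_apply]
    omega

theorem rauzyRot_pow_self {n : ℕ} (p : Fin n) (hp : p.val ≠ 0) :
    rauzyRot p ^ p.val = 1 := by
  obtain ⟨n, rfl⟩ : ∃ m, n = m + 1 := ⟨n - 1, by omega⟩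
  rw [rauzyRot, inv_pow, inv_eq_one]
  by_cases h : p.val = 1
  · have h0 : (⟨p - 1, by omega⟩ : Fin (n + 1)) = 0 := by ext; simp [h]
    rw [h0, Fin.cycleRange_zero, one_pow]
  · have h0 : (⟨p - 1, by omega⟩ : Fin (n + 1)) ≠ 0 := by
      rw [Ne, Fin.ext_iff]; simp; omega
    rw [← orderOf_dvd_iff_pow_eq_one, ← Perm.lcm_cycleType, Fin.cycleType_cycleRange h0]
    simp
    rw [Nat.sub_add_cancel (by omega)]

/-- The Rauzy operation `a` conjugated by the reversal of `Fin n`. -/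
def rauzyARev {n : ℕ} [NeZero n] (σ : Perm (Fin n)) : Perm (Fin n) :=
  rauzyRot (σ 0) * σ

theorem rauzyARev_iterate {n : ℕ} [NeZero n] (σ : Perm (Fin n)) (h : σ 0 ≠ 0) (j : ℕ) :
    rauzyARev^[j] σ = rauzyRot (σ 0) ^ j * σ := by
  induction j with
  | zero => simp
  | succ j ih =>
    rw [Function.iterate_succ_apply', ih, rauzyARev, Perm.mul_apply,
      rauzyRot_pow_apply_self _ (Fin.val_ne_zero_iff.2 h), pow_succ', mul_assoc]

theorem rauzyQ_rev {n : ℕ} (p : Fin n) :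
    rauzyQ p.rev = Fin.revPerm * rauzyRot p * Fin.revPerm := by
  have hr : (Fin.revPerm : Perm (Fin n))⁻¹ = Fin.revPerm := rfl
  have hp : (⟨n - 2 - p.rev.val, by omega⟩ : Fin n) = ⟨p - 1, by omega⟩ := by
    ext; simp only [Fin.val_rev]; omega
  rw [rauzyQ, rauzyRot, hp, mul_inv_rev, mul_inv_rev, hr, mul_assoc]

theorem rauzyA_conj {n : ℕ} [NeZero n] (σ : Perm (Fin n)) :
    rauzyA (Fin.revPerm * σ * Fin.revPerm) =
      Fin.revPerm * rauzyARev σ * Fin.revPerm := by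
  have h0 : (⟨n - 1, Nat.sub_one_lt (NeZero.ne n)⟩ : Fin n).rev = 0 := by
    have := NeZero.pos n
    ext; simp only [Fin.val_rev, Fin.val_zero]; omega
  have hrr : (Fin.revPerm : Perm (Fin n)) * Fin.revPerm = 1 := by ext; simp
  rw [rauzyA, dif_neg (NeZero.ne n), Perm.mul_apply, Perm.mul_apply, Fin.revPerm_apply,
    Fin.revPerm_apply, h0, rauzyQ_rev, rauzyARev]
  simp only [mul_assoc]
  rw [← mul_assoc Fin.revPerm Fin.revPerm, hrr, one_mul]

theorem rauzyB_eq {n : ℕ} (σ : Perm (Fin n)) : rauzyB σ = (rauzyA σ⁻¹)⁻¹ := by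
  unfold rauzyA rauzyB
  split_ifs <;> simp

theorem rauzyB_conj {n : ℕ} [NeZero n] (σ : Perm (Fin n)) :
    rauzyB (Fin.revPerm * σ * Fin.revPerm) =
      Fin.revPerm * (rauzyARev σ⁻¹)⁻¹ * Fin.revPerm := by
  have hr : (Fin.revPerm : Perm (Fin n))⁻¹ = Fin.revPerm := rfl
  rw [rauzyB_eq, mul_inv_rev, mul_inv_rev, hr, ← mul_assoc, rauzyA_conj, mul_inv_rev,
    mul_inv_rev, hr, mul_assoc]

/-- The element of the cycle of `σ⁻¹` under `rauzyARev` whose inverse sends `0` to `k`,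
when `σ` reverses the initial segment ending at `σ⁻¹ 0`. -/
def rauzyBranch {n : ℕ} [NeZero n] (k : ℕ) (σ : Perm (Fin n)) : Perm (Fin n) :=
  rauzyRot (σ⁻¹ 0) ^ ((σ⁻¹ 0).val - k) * σ⁻¹

/-- `σ` reverses the nonzero part of the initial segment ending at `σ⁻¹ 0`, and either sends `0`
beyond this segment or is the reversal. -/
structure IsRauzyBranch {n : ℕ} [NeZero n] (σ : Perm (Fin n)) : Prop where
  pos : 0 < (σ⁻¹ 0).val
  add_eq : ∀ i : Fin n, i.val ≠ 0 → i ≤ σ⁻¹ 0 → (σ i).val + i = (σ⁻¹ 0).val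
  lt_or_eq : σ⁻¹ 0 < σ 0 ∨ σ = Fin.revPerm

theorem isRauzyBranch_revPerm {n : ℕ} :
    IsRauzyBranch (Fin.revPerm : Perm (Fin (n + 2))) where
  pos := by simp [Perm.inv_def]
  add_eq i _ _ := by simp [Perm.inv_def]; omega
  lt_or_eq := Or.inr rfl

section Branch

variable {n : ℕ} [NeZero n] {σ : Perm (Fin n)} {k : ℕ}

theorem IsRauzyBranch.ne_zero (h : IsRauzyBranch σ) : σ⁻¹ 0 ≠ 0 :=
  Fin.val_ne_zero_iff.1 h.pos.ne'

theorem rauzyBranch_apply_zero (h : IsRauzyBranch σ) : rauzyBranch k σ 0 = σ⁻¹ 0 :=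
  rauzyRot_pow_apply_self _ h.pos.ne' _

theorem val_rauzyBranch_add (h : IsRauzyBranch σ) (hk : k < (σ⁻¹ 0).val)
    (i : Fin n) (hi : i.val ≠ 0) (hik : i.val ≤ k) : (rauzyBranch k σ i).val + i = k := by
  have hi' : σ⁻¹ i = ⟨(σ⁻¹ 0).val - i, by omega⟩ := by
    rw [Perm.inv_eq_iff_eq]
    ext
    have := h.add_eq ⟨(σ⁻¹ 0).val - i, by omega⟩ (by simp only; omega)
      (by rw [Fin.le_def]; simp only; omega)
    simp only at this
    omega
  have := val_rauzyRot_pow (p := σ⁻¹ 0) (x := σ⁻¹ i)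
    (by rw [hi', Fin.lt_def]; simp only; omega) ((σ⁻¹ 0).val - k) (by rw [hi']; simp only; omega)
  rw [rauzyBranch, Perm.mul_apply]
  rw [hi'] at this ⊢
  simp only at this
  omega

theorem rauzyBranch_inv_zero (h : IsRauzyBranch σ) (hk0 : k ≠ 0) (hk : k < (σ⁻¹ 0).val) :
    ((rauzyBranch k σ)⁻¹ 0).val = k := by
  have hkn : k < n := by omega
  suffices (rauzyBranch k σ)⁻¹ 0 = ⟨k, hkn⟩ by rw [this]
  rw [Perm.inv_eq_iff_eq]
  ext
  have := val_rauzyBranch_add h hk ⟨k, hkn⟩ hk0 le_rfl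
  rw [Fin.val_zero]
  simp only at this
  omega

theorem IsRauzyBranch.rauzyBranch (h : IsRauzyBranch σ) (hk0 : k ≠ 0) (hk : k < (σ⁻¹ 0).val) :
    IsRauzyBranch (rauzyBranch k σ) where
  pos := by rw [rauzyBranch_inv_zero h hk0 hk]; omega
  add_eq i hi hik := by
    rw [Fin.le_def, rauzyBranch_inv_zero h hk0 hk] at hik
    rw [rauzyBranch_inv_zero h hk0 hk, val_rauzyBranch_add h hk i hi hik]
  lt_or_eq := Or.inl <| by
    rw [Fin.lt_def, rauzyBranch_inv_zero h hk0 hk, rauzyBranch_apply_zero h]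
    exact hk

theorem rauzyARev_inv (h : IsRauzyBranch σ) :
    rauzyARev σ⁻¹ = if (σ⁻¹ 0).val = 1 then σ⁻¹ else rauzyBranch ((σ⁻¹ 0).val - 1) σ := by
  have := h.pos
  split_ifs with h1
  · have := rauzyRot_pow_self _ h.pos.ne'
    rw [h1, pow_one] at this
    rw [rauzyARev, this, one_mul]
  · rw [rauzyBranch, rauzyARev, Nat.sub_sub_self this, pow_one]

theorem rauzyARev_rauzyBranch (h : IsRauzyBranch σ) (hk0 : k ≠ 0) (hk : k < (σ⁻¹ 0).val) :
    rauzyARev (rauzyBranch k σ) = if k = 1 then σ⁻¹ else rauzyBranch (k - 1) σ := by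
  rw [rauzyARev, rauzyBranch_apply_zero h, rauzyBranch, ← mul_assoc, ← pow_succ']
  split_ifs with h1
  · rw [h1, Nat.sub_add_cancel (by omega), rauzyRot_pow_self _ h.pos.ne', one_mul]
  · rw [rauzyBranch]
    congr 2
    omega

theorem rauzyBranch_injOn (k : ℕ) :
    Set.InjOn (rauzyBranch k) {σ : Perm (Fin n) | IsRauzyBranch σ} := by
  intro σ hσ τ hτ h
  have h0 := congrArg (fun ρ : Perm (Fin n) => ρ 0) h
  simp only [rauzyBranch_apply_zero hσ, rauzyBranch_apply_zero hτ] at h0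
  rw [rauzyBranch, rauzyBranch, h0] at h
  exact inv_injective (mul_left_cancel h)

theorem IsRauzyBranch.eq_revPerm_of_inv (h : IsRauzyBranch σ) (h' : IsRauzyBranch σ⁻¹) :
    σ = Fin.revPerm := by
  rcases h.lt_or_eq with h1 | h1
  · rcases h'.lt_or_eq with h2 | h2
    · rw [inv_inv] at h2
      exact absurd h1 h2.asymm
    · rw [inv_eq_iff_eq_inv] at h2
      exact h2
  · exact h1

end Branch

/-- The permutations obtained from the reversal of `Fin (n + 2)` by successively branching at
some of the values `n, n - 1, …, n - d + 1`. -/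
def rauzyBranches (n : ℕ) : ℕ → Finset (Perm (Fin (n + 2)))
  | 0 => {Fin.revPerm}
  | d + 1 => rauzyBranches n d ∪ (rauzyBranches n d).image (rauzyBranch (n - d))

section Branches

variable {n d : ℕ}

theorem rauzyBranches_spec (hd : d ≤ n) {σ : Perm (Fin (n + 2))} (hσ : σ ∈ rauzyBranches n d) :
    IsRauzyBranch σ ∧ n + 1 ≤ (σ⁻¹ 0).val + d := by
  induction d generalizing σ with
  | zero =>
    rw [rauzyBranches, Finset.mem_singleton] at hσ
    subst hσ
    exact ⟨isRauzyBranch_revPerm, by simp [Perm.inv_def]⟩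
  | succ d ih =>
    rw [rauzyBranches, Finset.mem_union, Finset.mem_image] at hσ
    rcases hσ with hσ | ⟨τ, hτ, rfl⟩
    · obtain ⟨h1, h2⟩ := ih (by omega) hσ
      exact ⟨h1, by omega⟩
    · obtain ⟨h1, h2⟩ := ih (by omega) hτ
      refine ⟨h1.rauzyBranch (by omega) (by omega), ?_⟩
      rw [rauzyBranch_inv_zero h1 (by omega) (by omega)]
      omega

theorem card_rauzyBranches (hd : d ≤ n) : (rauzyBranches n d).card = 2 ^ d := by
  induction d with
  | zero => rfl
  | succ d ih =>
    rw [rauzyBranches, Finset.card_union_of_disjoint, Finset.card_image_of_injOn,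
      ih (by omega), pow_succ, mul_two]
    · exact (rauzyBranch_injOn _).mono fun σ hσ =>
        (rauzyBranches_spec (by omega) (Finset.mem_coe.1 hσ)).1
    · rw [Finset.disjoint_right]
      intro σ hσ hσ'
      obtain ⟨τ, hτ, rfl⟩ := Finset.mem_image.1 hσ
      obtain ⟨h1, h2⟩ := rauzyBranches_spec (by omega) hτ
      have h3 := (rauzyBranches_spec (by omega) hσ').2
      rw [rauzyBranch_inv_zero h1 (by omega) (by omega)] at h3
      omega

theorem rauzyBranches_mono : Monotone (rauzyBranches n) :=
  monotone_nat_of_le_succ fun _ => Finset.subset_union_left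

theorem revPerm_mem_rauzyBranches : Fin.revPerm ∈ rauzyBranches n d :=
  rauzyBranches_mono (Nat.zero_le d) (Finset.mem_singleton_self _)

theorem mem_rauzyBranches_of_le (hd : d ≤ n) {σ : Perm (Fin (n + 2))}
    (hσ : σ ∈ rauzyBranches n d) {e : ℕ} (he : n + 1 ≤ (σ⁻¹ 0).val + e) :
    σ ∈ rauzyBranches n e := by
  induction d with
  | zero => exact rauzyBranches_mono (Nat.zero_le e) hσ
  | succ d ih =>
    rcases Finset.mem_union.1 hσ with h | h
    · exact ih (by omega) h
    · obtain ⟨τ, hτ, rfl⟩ := Finset.mem_image.1 h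
      obtain ⟨h1, h2⟩ := rauzyBranches_spec (by omega) hτ
      rw [rauzyBranch_inv_zero h1 (by omega) (by omega)] at he
      exact rauzyBranches_mono (by omega) hσ

theorem rauzyBranch_mem {σ : Perm (Fin (n + 2))} (hσ : σ ∈ rauzyBranches n n) {k : ℕ}
    (hk0 : k ≠ 0) (hk : k < (σ⁻¹ 0).val) : rauzyBranch k σ ∈ rauzyBranches n n := by
  have h : σ ∈ rauzyBranches n (n - k) := mem_rauzyBranches_of_le le_rfl hσ (by omega)
  refine rauzyBranches_mono (show n - k + 1 ≤ n by omega) ?_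
  refine Finset.mem_union_right _ (Finset.mem_image.2 ⟨σ, h, ?_⟩)
  rw [Nat.sub_sub_self (by omega)]

theorem rauzyBranches_induction {P : Perm (Fin (n + 2)) → Prop} (base : P Fin.revPerm)
    (step : ∀ σ ∈ rauzyBranches n n, ∀ k, k ≠ 0 → k < (σ⁻¹ 0).val → P σ → P (rauzyBranch k σ))
    (hd : d ≤ n) {σ : Perm (Fin (n + 2))} (hσ : σ ∈ rauzyBranches n d) : P σ := by
  induction d generalizing σ with
  | zero => rwa [Finset.mem_singleton.1 hσ]
  | succ d ih =>
    rcases Finset.mem_union.1 hσ with h | h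
    · exact ih (by omega) h
    · obtain ⟨τ, hτ, rfl⟩ := Finset.mem_image.1 h
      obtain ⟨-, h2⟩ := rauzyBranches_spec (by omega) hτ
      exact step τ (rauzyBranches_mono (by omega) hτ) _ (by omega) (by omega) (ih (by omega) hτ)

/-- The Rauzy class of the reversal of `Fin (n + 2)`, conjugated by the reversal. -/
def rauzyRevClass (n : ℕ) : Finset (Perm (Fin (n + 2))) :=
  rauzyBranches n n ∪ (rauzyBranches n n).map (Equiv.inv _).toEmbedding

theorem mem_rauzyRevClass {σ : Perm (Fin (n + 2))} :
    σ ∈ rauzyRevClass n ↔ σ ∈ rauzyBranches n n ∨ σ⁻¹ ∈ rauzyBranches n n := by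
  simp [rauzyRevClass]

theorem inv_mem_rauzyRevClass {σ : Perm (Fin (n + 2))} (h : σ ∈ rauzyRevClass n) :
    σ⁻¹ ∈ rauzyRevClass n := by
  rw [mem_rauzyRevClass] at h ⊢
  rwa [inv_inv, or_comm]

theorem card_rauzyRevClass : (rauzyRevClass n).card = 2 ^ (n + 1) - 1 := by
  have h := Finset.card_union_add_card_inter (rauzyBranches n n)
    ((rauzyBranches n n).map (Equiv.inv _).toEmbedding)
  have hi : rauzyBranches n n ∩ (rauzyBranches n n).map (Equiv.inv _).toEmbedding
      = {Fin.revPerm} := by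
    ext σ
    rw [Finset.mem_inter, Finset.mem_singleton]
    constructor
    · rintro ⟨h1, h2⟩
      obtain ⟨τ, hτ, rfl⟩ := Finset.mem_map.1 h2
      refine (rauzyBranches_spec le_rfl h1).1.eq_revPerm_of_inv ?_
      simpa using (rauzyBranches_spec le_rfl hτ).1
    · rintro rfl
      exact ⟨revPerm_mem_rauzyBranches,
        Finset.mem_map.2 ⟨Fin.revPerm, revPerm_mem_rauzyBranches, rfl⟩⟩
  rw [hi, Finset.card_map, card_rauzyBranches le_rfl, Finset.card_singleton] at h
  rw [rauzyRevClass, pow_succ]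
  omega

theorem rauzyARev_inv_mem {σ : Perm (Fin (n + 2))} (hσ : σ ∈ rauzyBranches n n) :
    rauzyARev σ⁻¹ ∈ rauzyRevClass n := by
  have h := (rauzyBranches_spec le_rfl hσ).1
  have := h.pos
  rw [rauzyARev_inv h, mem_rauzyRevClass]
  split_ifs with h1
  · exact Or.inr (by rwa [inv_inv])
  · exact Or.inl (rauzyBranch_mem hσ (by omega) (by omega))

theorem rauzyARev_mem {σ : Perm (Fin (n + 2))} (hσ : σ ∈ rauzyRevClass n) :
    rauzyARev σ ∈ rauzyRevClass n := by
  rcases mem_rauzyRevClass.1 hσ with h | h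
  · refine rauzyBranches_induction (P := fun σ => rauzyARev σ ∈ rauzyRevClass n)
      (rauzyARev_inv_mem (σ := Fin.revPerm) revPerm_mem_rauzyBranches) ?_ le_rfl h
    intro τ hτ k hk0 hk _
    rw [rauzyARev_rauzyBranch (rauzyBranches_spec le_rfl hτ).1 hk0 hk, mem_rauzyRevClass]
    split_ifs with h1
    · exact Or.inr (by rwa [inv_inv])
    · exact Or.inl (rauzyBranch_mem hτ (by omega) (by omega))
  · simpa using rauzyARev_inv_mem h

theorem rauzyRevClass_subset {S : Set (Perm (Fin (n + 2)))} (h0 : Fin.revPerm ∈ S)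
    (ha : ∀ σ ∈ S, rauzyARev σ ∈ S) (hb : ∀ σ ∈ S, (rauzyARev σ⁻¹)⁻¹ ∈ S) :
    ↑(rauzyRevClass n) ⊆ S := by
  suffices h : ∀ σ ∈ rauzyBranches n n, σ ∈ S ∧ σ⁻¹ ∈ S by
    intro σ hσ
    rcases mem_rauzyRevClass.1 hσ with hσ | hσ
    · exact (h σ hσ).1
    · simpa using (h _ hσ).2
  intro σ hσ
  refine rauzyBranches_induction (P := fun σ => σ ∈ S ∧ σ⁻¹ ∈ S) ⟨h0, h0⟩ ?_ le_rfl hσ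
  rintro τ hτ k - - ⟨h1, h2⟩
  have key : ∀ j, rauzyARev^[j] τ⁻¹ ∈ S ∧ (rauzyARev^[j] τ⁻¹)⁻¹ ∈ S := by
    intro j
    induction j with
    | zero => exact ⟨h2, by simpa using h1⟩
    | succ j ih =>
      rw [Function.iterate_succ_apply']
      exact ⟨ha _ ih.1, by simpa using hb _ ih.2⟩
  have := key ((τ⁻¹ 0).val - k)
  rwa [rauzyARev_iterate _ (rauzyBranches_spec le_rfl hτ).1.ne_zero] at this

theorem rauzyClass_revPerm :
    RauzyClass (Fin.revPerm : Perm (Fin (n + 2))) =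
      (fun σ => Fin.revPerm * σ * Fin.revPerm) '' (rauzyRevClass n : Set (Perm (Fin (n + 2)))) := by
  have hrr : (Fin.revPerm : Perm (Fin (n + 2))) * Fin.revPerm = 1 := by ext; simp
  apply subset_antisymm
  · intro σ hσ
    refine hσ _ ⟨Fin.revPerm, mem_rauzyRevClass.2 (Or.inl revPerm_mem_rauzyBranches),
      by simp only [hrr, one_mul]⟩ ?_ ?_
    · rintro _ ⟨τ, hτ, rfl⟩
      exact ⟨_, rauzyARev_mem hτ, (rauzyA_conj τ).symm⟩
    · rintro _ ⟨τ, hτ, rfl⟩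
      exact ⟨_, inv_mem_rauzyRevClass (rauzyARev_mem (inv_mem_rauzyRevClass hτ)),
        (rauzyB_conj τ).symm⟩
  · rw [Set.image_subset_iff]
    intro σ hσ S h0 ha hb
    refine rauzyRevClass_subset (S := (fun σ => Fin.revPerm * σ * Fin.revPerm) ⁻¹' S)
      ?_ ?_ ?_ hσ
    · rwa [Set.mem_preimage, hrr, one_mul]
    · intro τ hτ
      rw [Set.mem_preimage, ← rauzyA_conj]
      exact ha _ hτ
    · intro τ hτ
      rw [Set.mem_preimage, ← rauzyB_conj]
      exact hb _ hτ

end Branches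

/-- The Rauzy class of the permutation `i ↦ n + 1 - i`
(`0`-indexed: `i ↦ (n - 1) - i`, i.e. `Fin.rev`) has exactly `2 ^ (n - 1) - 1`
elements. -/
theorem ncard_rauzyClass_rev (n : ℕ) (hn : 2 ≤ n) (π₀ : Equiv.Perm (Fin n))
    (hπ₀ : ∀ i, π₀ i = i.rev) :
    (RauzyClass π₀).ncard = 2 ^ (n - 1) - 1 := by
  obtain ⟨n, rfl⟩ : ∃ m, n = m + 2 := ⟨n - 2, by omega⟩
  obtain rfl : π₀ = Fin.revPerm := Equiv.ext hπ₀
  rw [rauzyClass_revPerm, Set.ncard_image_of_injective, Set.ncard_coe_finset, card_rauzyRevClass]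
  · rfl
  · intro σ τ h
    exact mul_left_cancel (mul_right_cancel h)
end

section
/- Let π and σ be the permutations of {1,…,7} determined by the bottom-line words (4,3,7,6,5,2,1) and (5,4,3,7,6,2,1) respectively. Both are irreducible, they belong to the same extended Rauzy class, R_ex(π) = R_ex(σ), but their Rauzy classes are distinct: σ ∉ R(π). (Both represent the connected stratum H(3,1); the two Rauzy classes correspond to the two choices of the singularity at the left endpoint of the interval.) -/
/-- The permutation of the top-line symbols that follows the left endpoints of the subintervals
around the singularities; the cycle of `0` belongs to the singularity at the left endpoint of the
whole interval. -/
def singularityPerm (τ : Equiv.Perm (Fin 7)) : Equiv.Perm (Fin 7) :=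
  finRotate 7 * Equiv.swap 6 (τ⁻¹ 6) * τ⁻¹ * (finRotate 7)⁻¹ * τ

theorem singularityPerm_rauzyA (τ : Equiv.Perm (Fin 7)) :
    singularityPerm (rauzyA τ) = singularityPerm τ := by
  have key : ∀ m : Fin 7, Equiv.swap m ((rauzyQ m)⁻¹ 6) * (rauzyQ m)⁻¹ * (finRotate 7)⁻¹ *
      rauzyQ m = Equiv.swap m 6 * (finRotate 7)⁻¹ := by decide +kernel
  have hA : rauzyA τ = rauzyQ (τ 6) * τ := rfl
  have hswap : ∀ x : Fin 7, Equiv.swap 6 (τ⁻¹ x) = τ⁻¹ * Equiv.swap (τ 6) x * τ := fun x => by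
    have h := Equiv.swap_apply_apply τ⁻¹ (τ 6) x
    rwa [show τ⁻¹ (τ 6) = 6 from τ.symm_apply_apply 6, inv_inv] at h
  have h := congrArg (fun p => finRotate 7 * τ⁻¹ * p * τ) (key (τ 6))
  simpa only [singularityPerm, hA, mul_inv_rev, Equiv.Perm.mul_apply, hswap, mul_assoc,
    mul_inv_cancel_left] using h

theorem singularityPerm_rauzyB (τ : Equiv.Perm (Fin 7)) :
    singularityPerm (rauzyB τ) =
      rauzyQ (τ⁻¹ 6) * singularityPerm τ * (rauzyQ (τ⁻¹ 6))⁻¹ := by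
  have key : ∀ m : Fin 7, finRotate 7 * Equiv.swap 6 (rauzyQ m m) * rauzyQ m =
      rauzyQ m * (finRotate 7 * Equiv.swap 6 m) := by decide +kernel
  have hB : rauzyB τ = τ * (rauzyQ (τ⁻¹ 6))⁻¹ := rfl
  have h := congrArg (fun p => p * τ⁻¹ * (finRotate 7)⁻¹ * τ * (rauzyQ (τ⁻¹ 6))⁻¹) (key (τ⁻¹ 6))
  simpa only [singularityPerm, hB, mul_inv_rev, inv_inv, Equiv.Perm.mul_apply, mul_assoc] using h

theorem singularityPerm_rauzyB_pow_apply_zero (τ : Equiv.Perm (Fin 7)) (k : ℕ) :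
    (singularityPerm (rauzyB τ) ^ k) 0 = 0 ↔ (singularityPerm τ ^ k) 0 = 0 := by
  have hzero : ∀ m : Fin 7, rauzyQ m 0 = 0 := by decide +kernel
  have hinv : (rauzyQ (τ⁻¹ 6))⁻¹ 0 = 0 := by rw [Equiv.Perm.inv_eq_iff_eq, hzero]
  rw [singularityPerm_rauzyB, conj_pow, Equiv.Perm.mul_apply, Equiv.Perm.mul_apply, hinv,
    ← Equiv.Perm.eq_inv_iff_eq, hinv]

/-- The length of the cycle of the left endpoint is constant on Rauzy classes. -/
theorem singularityPerm_pow_apply_zero_of_mem {τ π : Equiv.Perm (Fin 7)} (h : τ ∈ RauzyClass π)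
    (k : ℕ) : (singularityPerm τ ^ k) 0 = 0 ↔ (singularityPerm π ^ k) 0 = 0 := by
  refine h {ρ | (singularityPerm ρ ^ k) 0 = 0 ↔ (singularityPerm π ^ k) 0 = 0} Iff.rfl ?_ ?_
  · intro ρ hρ
    rwa [Set.mem_ofPred_eq, singularityPerm_rauzyA]
  · intro ρ hρ
    exact (singularityPerm_rauzyB_pow_apply_zero ρ k).trans hρ

theorem rauzyC_rauzyC {n : ℕ} (τ : Equiv.Perm (Fin n)) : rauzyC (rauzyC τ) = τ := by
  ext i
  simp [rauzyC]

theorem rauzyClassEx_rauzyC_subset {n : ℕ} (τ : Equiv.Perm (Fin n)) :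
    RauzyClassEx (rauzyC τ) ⊆ RauzyClassEx τ :=
  fun _ h S hτ hA hB hC => h S (hC τ hτ) hA hB hC

theorem rauzyClassEx_rauzyC {n : ℕ} (τ : Equiv.Perm (Fin n)) :
    RauzyClassEx (rauzyC τ) = RauzyClassEx τ := by
  refine (rauzyClassEx_rauzyC_subset τ).antisymm ?_
  simpa only [rauzyC_rauzyC] using rauzyClassEx_rauzyC_subset (rauzyC τ)

/-- The permutation with bottom line `(4,3,7,6,5,2,1)`. -/
def permH31 : Equiv.Perm (Fin 7) where
  toFun := ![6, 5, 1, 0, 4, 3, 2]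
  invFun := ![3, 2, 6, 5, 4, 1, 0]
  left_inv := by decide
  right_inv := by decide

theorem irreduciblePerm_of_apply_zero {n : ℕ} {π : Equiv.Perm (Fin (n + 1))}
    (h : π 0 = Fin.last n) : IrreduciblePerm π := by
  intro k hk hπ
  have h0 := hπ 0 (Nat.zero_le k)
  rw [h, Fin.val_last] at h0
  omega

/-- The permutations of `{1, …, 7}` with bottom lines
`(4,3,7,6,5,2,1)` and `(5,4,3,7,6,2,1)` are irreducible, have the same
extended Rauzy class, but distinct Rauzy classes (both represent the
connected stratum `H(3,1)`). -/
theorem rauzyClass_H31_two_classes (π σ : Equiv.Perm (Fin 7))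
    (hπ : ∀ i, π⁻¹ i = ![3,2,6,5,4,1,0] i)
    (hσ : ∀ i, σ⁻¹ i = ![4,3,2,6,5,1,0] i) :
    IrreduciblePerm π ∧ IrreduciblePerm σ ∧
      RauzyClassEx π = RauzyClassEx σ ∧ σ ∉ RauzyClass π := by
  obtain rfl : π = permH31 := inv_injective (Equiv.ext hπ)
  have hC : ∀ i, (rauzyC permH31)⁻¹ i = ![4,3,2,6,5,1,0] i := by decide +kernel
  obtain rfl : σ = rauzyC permH31 :=
    inv_injective (Equiv.ext fun i => (hσ i).trans (hC i).symm)
  refine ⟨irreduciblePerm_of_apply_zero rfl,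
    irreduciblePerm_of_apply_zero (by decide +kernel), (rauzyClassEx_rauzyC _).symm, fun h => ?_⟩
  have hcycle := singularityPerm_pow_apply_zero_of_mem h 3
  revert hcycle
  decide +kernel
end

section
/- Let π and σ be the permutations of {1,…,6} determined by the bottom-line words (6,5,4,3,2,1) and (4,3,6,5,2,1) respectively. Then the Rauzy class R(π) has exactly 31 elements and the Rauzy class R(σ) has exactly 134 elements. -/
/-- Depth-first search from the points of the second list along the maps `f` and `g`, where the
first list holds the points already visited. The result is `none` if the search does not end within
the given number of steps. -/
def closureSearch {α : Type*} [DecidableEq α] (f g : α → α) :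
    ℕ → List α → List α → Option (List α)
  | 0, _, _ => none
  | _ + 1, visited, [] => some visited
  | k + 1, visited, x :: todo =>
    if x ∈ visited then closureSearch f g k visited todo
    else closureSearch f g k (x :: visited) (f x :: g x :: todo)

theorem closureSearch_subset {α : Type*} [DecidableEq α] {f g : α → α} {S : Set α}
    (hf : ∀ x ∈ S, f x ∈ S) (hg : ∀ x ∈ S, g x ∈ S) {k : ℕ} {visited todo L : List α}
    (hL : closureSearch f g k visited todo = some L)
    (hv : ∀ x ∈ visited, x ∈ S) (ht : ∀ x ∈ todo, x ∈ S) : ∀ x ∈ L, x ∈ S := by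
  fun_induction closureSearch f g k visited todo with
  | case1 => simp at hL
  | case2 => simpa [← Option.some.inj hL] using hv
  | case3 k visited x todo _ ih =>
    exact ih hL hv fun y hy => ht y (List.mem_cons_of_mem x hy)
  | case4 k visited x todo _ ih =>
    simp only [List.forall_mem_cons] at ht ih
    exact ih hL ⟨ht.1, hv⟩ ⟨hf x ht.1, hg x ht.1, ht.2⟩

theorem subset_closureSearch {α : Type*} [DecidableEq α] {f g : α → α} {k : ℕ}
    {visited todo L : List α} (hL : closureSearch f g k visited todo = some L) :
    ∀ x, x ∈ visited ∨ x ∈ todo → x ∈ L := by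
  fun_induction closureSearch f g k visited todo with
  | case1 => simp at hL
  | case2 => simp [← Option.some.inj hL]
  | case3 k visited x todo _ ih => grind
  | case4 k visited x todo _ ih => grind

theorem closureSearch_nodup {α : Type*} [DecidableEq α] {f g : α → α} {k : ℕ}
    {visited todo L : List α} (hL : closureSearch f g k visited todo = some L)
    (hv : visited.Nodup) : L.Nodup := by
  fun_induction closureSearch f g k visited todo with
  | case1 => simp at hL
  | case2 => rwa [← Option.some.inj hL]
  | case3 k visited x todo _ ih => exact ih hL hv
  | case4 k visited x todo hx ih => exact ih hL (hv.cons hx)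

theorem closureSearch_closed {α : Type*} [DecidableEq α] {f g : α → α} {k : ℕ}
    {visited todo L : List α} (hL : closureSearch f g k visited todo = some L)
    (hv : ∀ x ∈ visited, (f x ∈ visited ∨ f x ∈ todo) ∧ (g x ∈ visited ∨ g x ∈ todo)) :
    ∀ x ∈ L, f x ∈ L ∧ g x ∈ L := by
  fun_induction closureSearch f g k visited todo with
  | case1 => simp at hL
  | case2 => simpa [← Option.some.inj hL] using hv
  | case3 k visited x todo hx ih =>
    have key : ∀ z, z ∈ visited ∨ z ∈ x :: todo → z ∈ visited ∨ z ∈ todo := by grind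
    exact ih hL fun y hy => ⟨key _ (hv y hy).1, key _ (hv y hy).2⟩
  | case4 k visited x todo _ ih =>
    have key : ∀ z, z ∈ visited ∨ z ∈ x :: todo →
        z ∈ x :: visited ∨ z ∈ f x :: g x :: todo := by grind
    refine ih hL fun y hy => ?_
    rcases List.mem_cons.1 hy with rfl | hy
    · simp
    · exact ⟨key _ (hv y hy).1, key _ (hv y hy).2⟩

/-- The list of values of a permutation. -/
def permValues {n : ℕ} (π : Equiv.Perm (Fin n)) : List ℕ :=
  List.ofFn fun i => (π i).val

theorem permValues_injective {n : ℕ} :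
    Function.Injective (permValues : Equiv.Perm (Fin n) → List ℕ) := fun _ _ h =>
  Equiv.ext fun i => Fin.ext (congrFun (List.ofFn_injective h) i)

theorem permValues_nodup {n : ℕ} (π : Equiv.Perm (Fin n)) : (permValues π).Nodup :=
  List.nodup_ofFn.2 (Fin.val_injective.comp π.injective)

/-- The effect of `rauzyA` on the list of values of a permutation of `Fin 6`. -/
def rauzyAValues (l : List ℕ) : List ℕ :=
  l.map fun x => if x ≤ l.getD 5 0 then x else if x = 5 then l.getD 5 0 + 1 else x + 1

/-- The effect of `rauzyB` on the list of values of a permutation of `Fin 6`. -/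
def rauzyBValues (l : List ℕ) : List ℕ :=
  (List.range 6).map fun i => l.getD
    (if i ≤ l.idxOf 5 then i else if i = l.idxOf 5 + 1 then 5 else i - 1) 0

theorem rauzyQ_val (m j : Fin 6) :
    (rauzyQ m j).val =
      if j.val ≤ m.val then j.val else if j.val = 5 then m.val + 1 else j.val + 1 := by
  revert m j
  decide

theorem rauzyQ_inv_val (m j : Fin 6) :
    ((rauzyQ m)⁻¹ j).val =
      if j.val ≤ m.val then j.val else if j.val = m.val + 1 then 5 else j.val - 1 := by
  revert m j
  decide

theorem permValues_getD {n : ℕ} (π : Equiv.Perm (Fin n)) (i : Fin n) :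
    (permValues π).getD i.val 0 = (π i).val := by
  simp [permValues]

theorem permValues_idxOf {n : ℕ} (π : Equiv.Perm (Fin n)) (i : Fin n) :
    (permValues π).idxOf i.val = (π⁻¹ i).val := by
  have h := (permValues_nodup π).idxOf_getElem (π⁻¹ i).val (by simp [permValues])
  simpa [permValues] using h

theorem permValues_rauzyA (π : Equiv.Perm (Fin 6)) :
    permValues (rauzyA π) = rauzyAValues (permValues π) := by
  unfold rauzyAValues
  rw [show (permValues π).getD 5 0 = (π 5).val from permValues_getD π 5]
  simp only [permValues, List.map_ofFn]
  congr 1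
  funext i
  exact rauzyQ_val (π 5) (π i)

theorem permValues_rauzyB (π : Equiv.Perm (Fin 6)) :
    permValues (rauzyB π) = rauzyBValues (permValues π) := by
  unfold rauzyBValues
  rw [show (permValues π).idxOf 5 = (π⁻¹ 5).val from permValues_idxOf π 5]
  refine List.ext_getElem (by simp [permValues]) fun i hi _ => ?_
  have hi : i < 6 := by simpa [permValues] using hi
  have h := permValues_getD π ((rauzyQ (π⁻¹ 5))⁻¹ ⟨i, hi⟩)
  rw [rauzyQ_inv_val] at h
  simp only [List.getElem_map, List.getElem_range, h]
  simp only [permValues, List.getElem_ofFn]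
  rfl

theorem ncard_rauzyClass_of_closureSearch {π : Equiv.Perm (Fin 6)} {k m : ℕ}
    (h : (closureSearch rauzyAValues rauzyBValues k [] [permValues π]).map List.length = some m) :
    (RauzyClass π).ncard = m := by
  obtain ⟨L, hL, rfl⟩ := Option.map_eq_some_iff.1 h
  have hclosed := closureSearch_closed hL (by simp)
  have himage : permValues '' RauzyClass π = {x | x ∈ L} := by
    apply Set.Subset.antisymm
    · rintro _ ⟨τ, hτ, rfl⟩
      refine hτ {τ | permValues τ ∈ L} (subset_closureSearch hL _ (by simp))
        (fun τ hτ => ?_) fun τ hτ => ?_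
      · simpa only [Set.mem_ofPred_eq, permValues_rauzyA] using (hclosed _ hτ).1
      · simpa only [Set.mem_ofPred_eq, permValues_rauzyB] using (hclosed _ hτ).2
    · refine closureSearch_subset ?_ ?_ hL (by simp) ?_
      · rintro _ ⟨τ, hτ, rfl⟩
        exact ⟨rauzyA τ, fun S h hA hB => hA τ (hτ S h hA hB), permValues_rauzyA τ⟩
      · rintro _ ⟨τ, hτ, rfl⟩
        exact ⟨rauzyB τ, fun S h hA hB => hB τ (hτ S h hA hB), permValues_rauzyB τ⟩
      · simpa using ⟨π, fun S h _ _ => h, rfl⟩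
  rw [← Set.ncard_image_of_injective _ permValues_injective, himage, ← List.coe_toFinset,
    Set.ncard_coe_finset, List.toFinset_card_of_nodup (closureSearch_nodup hL List.nodup_nil)]

theorem permValues_eq_of_inv {π : Equiv.Perm (Fin 6)} {w v : Fin 6 → Fin 6}
    (h : ∀ i, π⁻¹ i = w i) (hw : ∀ i, w (v i) = i) :
    permValues π = List.ofFn fun i => (v i).val := by
  have hv : ∀ i, π i = v i := fun i => by
    rw [← Equiv.Perm.eq_inv_iff_eq, h, hw]
  simp only [permValues, hv]

/-- The Rauzy class of the permutation of `{1, …, 6}` with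
bottom line `(6,5,4,3,2,1)` has exactly `31` elements, and the Rauzy class of
the one with bottom line `(4,3,6,5,2,1)` has exactly `134` elements. -/
theorem ncard_rauzyClass_H4 (π σ : Equiv.Perm (Fin 6))
    (hπ : ∀ i, π⁻¹ i = ![5,4,3,2,1,0] i)
    (hσ : ∀ i, σ⁻¹ i = ![3,2,5,4,1,0] i) :
    (RauzyClass π).ncard = 31 ∧ (RauzyClass σ).ncard = 134 := by
  have hπ' : permValues π = [5, 4, 3, 2, 1, 0] :=
    permValues_eq_of_inv (v := ![5, 4, 3, 2, 1, 0]) hπ (by decide)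
  have hσ' : permValues σ = [5, 4, 1, 0, 3, 2] :=
    permValues_eq_of_inv (v := ![5, 4, 1, 0, 3, 2]) hσ (by decide)
  constructor
  · apply ncard_rauzyClass_of_closureSearch (k := 64)
    rw [hπ']
    decide +kernel
  · apply ncard_rauzyClass_of_closureSearch (k := 270)
    rw [hσ']
    decide +kernel
end

section
/- Let π and σ be the permutations of {1,…,7} determined by the bottom-line words (4,3,7,6,5,2,1) and (5,4,3,7,6,2,1) respectively. Then the Rauzy class R(π) has exactly 509 elements and the Rauzy class R(σ) has exactly 261 elements. -/
/-- The closure of `{x}` under two self-maps `f` and `g`. -/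
inductive ReachableBy {α : Type*} (f g : α → α) (x : α) : α → Prop
  | base : ReachableBy f g x x
  | left {y : α} : ReachableBy f g x y → ReachableBy f g x (f y)
  | right {y : α} : ReachableBy f g x y → ReachableBy f g x (g y)

theorem rauzyClass_eq_setOf_reachableBy {n : ℕ} (π : Equiv.Perm (Fin n)) :
    RauzyClass π = {σ | ReachableBy rauzyA rauzyB π σ} := by
  ext σ
  constructor
  · intro h
    exact h {σ | ReachableBy rauzyA rauzyB π σ} .base (fun _ => .left) (fun _ => .right)
  · intro h S h₀ hA hB
    induction h with
    | base => exact h₀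
    | left _ ih => exact hA _ ih
    | right _ ih => exact hB _ ih

theorem image_setOf_reachableBy {α β : Type*} {f g : α → α} {f' g' : β → β} (e : α → β)
    (hf : ∀ x, e (f x) = f' (e x)) (hg : ∀ x, e (g x) = g' (e x)) (x : α) :
    e '' {y | ReachableBy f g x y} = {z | ReachableBy f' g' (e x) z} := by
  ext z
  constructor
  · rintro ⟨y, hy, rfl⟩
    induction hy with
    | base => exact .base
    | left _ ih => rw [hf]; exact .left ih
    | right _ ih => rw [hg]; exact .right ih
  · intro hz
    induction hz with
    | base => exact ⟨x, .base, rfl⟩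
    | left _ ih =>
      obtain ⟨y, hy, rfl⟩ := ih
      exact ⟨f y, .left hy, hf y⟩
    | right _ ih =>
      obtain ⟨y, hy, rfl⟩ := ih
      exact ⟨g y, .right hy, hg y⟩

/-- Depth-first search along `f` and `g`, using at most `fuel` steps: `todo` is the stack of
vertices still to be visited and `seen` the list of vertices already visited. -/
def explore (f g : ℕ → ℕ) (fuel : ℕ) : List ℕ → List ℕ → Option (List ℕ) :=
  fuel.rec (fun _ _ => none) fun _ ih todo seen =>
    todo.rec (some seen) fun x rest _ =>
      bif seen.any (Nat.beq x) then ih rest seen else ih (f x :: g x :: rest) (x :: seen)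

theorem explore_spec {f g : ℕ → ℕ} {x : ℕ} {result : List ℕ} (fuel : ℕ) (todo seen : List ℕ)
    (hnodup : seen.Nodup) (hreach : ∀ y, y ∈ todo ∨ y ∈ seen → ReachableBy f g x y)
    (hx : x ∈ todo ∨ x ∈ seen)
    (hclosed : ∀ y ∈ seen, (f y ∈ todo ∨ f y ∈ seen) ∧ (g y ∈ todo ∨ g y ∈ seen))
    (h : explore f g fuel todo seen = some result) :
    result.Nodup ∧ ∀ y, y ∈ result ↔ ReachableBy f g x y := by
  induction fuel generalizing todo seen with
  | zero => simp [explore] at h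
  | succ fuel ih =>
    cases todo with
    | nil =>
      obtain rfl : seen = result := by simpa [explore] using h
      refine ⟨hnodup, fun y => ⟨fun hy => hreach y (.inr hy), fun hy => ?_⟩⟩
      simp only [List.not_mem_nil, false_or] at hx hclosed
      induction hy with
      | base => exact hx
      | left _ ih => exact (hclosed _ ih).1
      | right _ ih => exact (hclosed _ ih).2
    | cons y rest =>
      have hstep : explore f g (fuel + 1) (y :: rest) seen =
          bif seen.any (Nat.beq y) then explore f g fuel rest seen
          else explore f g fuel (f y :: g y :: rest) (y :: seen) := rfl
      have hmem : seen.any (Nat.beq y) = true ↔ y ∈ seen := by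
        simp [List.any_eq_true]
      rw [hstep] at h
      by_cases hy : y ∈ seen
      · rw [hmem.2 hy, cond_true] at h
        refine ih _ _ hnodup ?_ ?_ ?_ h <;> grind
      · rw [Bool.eq_false_iff.2 (mt hmem.1 hy), cond_false] at h
        have hy' := hreach y (by simp)
        refine ih _ _ (List.nodup_cons.2 ⟨hy, hnodup⟩) ?_ ?_ ?_ h
        · have := hy'.left
          have := hy'.right
          grind
        · grind
        · grind

theorem ncard_setOf_reachableBy {f g : ℕ → ℕ} {x k : ℕ} (fuel : ℕ)
    (h : (explore f g fuel [x] []).map List.length = some k) :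
    {y | ReachableBy f g x y}.ncard = k := by
  obtain ⟨result, hresult, rfl⟩ := Option.map_eq_some_iff.1 h
  obtain ⟨hnodup, hmem⟩ := explore_spec (x := x) fuel [x] [] List.nodup_nil
    (by simp [ReachableBy.base]) (by simp) (by simp) hresult
  have : {y | ReachableBy f g x y} = (result.toFinset : Set ℕ) := by
    ext y
    simp [hmem]
  rw [this, Set.ncard_coe_finset, List.toFinset_card_of_nodup hnodup]

/-- The number with base `7` digits `w 0, …, w 6`. -/
def encodeWord (w : ℕ → ℕ) : ℕ :=
  w 0 + 7 * (w 1 + 7 * (w 2 + 7 * (w 3 + 7 * (w 4 + 7 * (w 5 + 7 * w 6)))))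

/-- The base `7` digit of `c` at position `i`. -/
def wordDigit (c i : ℕ) : ℕ := c / 7 ^ i % 7

theorem wordDigit_encodeWord {w : ℕ → ℕ} (hw : ∀ i < 7, w i < 7) {i : ℕ} (hi : i < 7) :
    wordDigit (encodeWord w) i = w i := by
  have h0 := hw 0 (by omega)
  have h1 := hw 1 (by omega)
  have h2 := hw 2 (by omega)
  have h3 := hw 3 (by omega)
  have h4 := hw 4 (by omega)
  have h5 := hw 5 (by omega)
  have h6 := hw 6 (by omega)
  unfold wordDigit encodeWord
  interval_cases i <;> norm_num only <;> omega

theorem encodeWord_congr {v w : ℕ → ℕ} (h : ∀ i < 7, v i = w i) :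
    encodeWord v = encodeWord w := by
  simp [encodeWord, h]

/-- The values of `rauzyQ m`, for `m` a letter of a word of length `7`. -/
def shiftLetter (m i : ℕ) : ℕ :=
  bif i.ble m then i else bif i.beq 6 then m + 1 else i + 1

/-- The values of the inverse of `rauzyQ m`, for `m` a position in a word of length `7`. -/
def unshiftPosition (m i : ℕ) : ℕ :=
  bif i.ble m then i else bif i.beq (m + 1) then 6 else i - 1

theorem val_rauzyQ (m i : Fin 7) : (rauzyQ m i).val = shiftLetter m i := by
  revert m i
  decide +kernel

theorem val_rauzyQ_inv (m i : Fin 7) : ((rauzyQ m)⁻¹ i).val = unshiftPosition m i := by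
  revert m i
  decide +kernel

/-- The position of the digit `6` in the word encoded by `c`. -/
def positionOfSix (c : ℕ) : ℕ :=
  (List.range 7).findIdx fun i => (wordDigit c i).beq 6

/-- The operation `a` on encoded bottom words. -/
def codeA (c : ℕ) : ℕ :=
  encodeWord fun i => wordDigit c (unshiftPosition (positionOfSix c) i)

/-- The operation `b` on encoded bottom words. -/
def codeB (c : ℕ) : ℕ :=
  encodeWord fun i => shiftLetter (wordDigit c 6) (wordDigit c i)

/-- The code of the bottom word of a permutation. -/
def encodePerm (π : Equiv.Perm (Fin 7)) : ℕ :=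
  encodeWord fun i => (π⁻¹ (Fin.ofNat 7 i)).val

theorem wordDigit_encodePerm (π : Equiv.Perm (Fin 7)) (i : Fin 7) :
    wordDigit (encodePerm π) i = (π⁻¹ i).val := by
  rw [encodePerm, wordDigit_encodeWord (fun _ _ => Fin.isLt _) i.isLt, Fin.ofNat_val_eq_self]

theorem encodePerm_injective : Function.Injective encodePerm := by
  intro π σ h
  rw [← inv_inj]
  ext i
  rw [← wordDigit_encodePerm, h, wordDigit_encodePerm]

theorem positionOfSix_encodePerm (π : Equiv.Perm (Fin 7)) :
    positionOfSix (encodePerm π) = (π 6).val := by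
  have key (i : Fin 7) : (wordDigit (encodePerm π) i).beq 6 = true ↔ i = π 6 := by
    rw [wordDigit_encodePerm, Nat.beq_eq, ← Equiv.Perm.inv_eq_iff_eq]
    exact Fin.val_inj (b := 6)
  rw [positionOfSix, List.findIdx_eq (by simp)]
  refine ⟨by simpa using (key (π 6)).2 rfl, fun j hj => ?_⟩
  rw [List.getElem_range, Bool.eq_false_iff]
  intro h
  have := (key ⟨j, by omega⟩).1 h
  simp [← this] at hj

theorem encodePerm_rauzyA (π : Equiv.Perm (Fin 7)) :
    encodePerm (rauzyA π) = codeA (encodePerm π) := by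
  refine encodeWord_congr fun i hi => ?_
  have hi' : Fin.ofNat 7 i = ⟨i, hi⟩ := Fin.ext (Nat.mod_eq_of_lt hi)
  rw [positionOfSix_encodePerm, hi', ← val_rauzyQ_inv (π 6) ⟨i, hi⟩, wordDigit_encodePerm]
  simp [rauzyA]

theorem encodePerm_rauzyB (π : Equiv.Perm (Fin 7)) :
    encodePerm (rauzyB π) = codeB (encodePerm π) := by
  refine encodeWord_congr fun i hi => ?_
  have hi' : Fin.ofNat 7 i = ⟨i, hi⟩ := Fin.ext (Nat.mod_eq_of_lt hi)
  have hlast : wordDigit (encodePerm π) 6 = (π⁻¹ 6).val := wordDigit_encodePerm π 6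
  have hdigit : wordDigit (encodePerm π) i = (π⁻¹ ⟨i, hi⟩).val := wordDigit_encodePerm π ⟨i, hi⟩
  rw [hlast, hdigit, ← val_rauzyQ, hi']
  simp [rauzyB]

theorem ncard_rauzyClass_eq {π : Equiv.Perm (Fin 7)} {k : ℕ} (fuel c : ℕ) (hc : encodePerm π = c)
    (h : (explore codeA codeB fuel [c] []).map List.length = some k) :
    (RauzyClass π).ncard = k := by
  rw [← Set.ncard_image_of_injective _ encodePerm_injective, rauzyClass_eq_setOf_reachableBy,
    image_setOf_reachableBy encodePerm encodePerm_rauzyA encodePerm_rauzyB, hc]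
  exact ncard_setOf_reachableBy fuel h

/-- The Rauzy class of the permutation of `{1, …, 7}` with
bottom line `(4,3,7,6,5,2,1)` has exactly `509` elements, and the Rauzy class
of the one with bottom line `(5,4,3,7,6,2,1)` has exactly `261` elements. -/
theorem ncard_rauzyClass_H31 (π σ : Equiv.Perm (Fin 7))
    (hπ : ∀ i, π⁻¹ i = ![3,2,6,5,4,1,0] i)
    (hσ : ∀ i, σ⁻¹ i = ![4,3,2,6,5,1,0] i) :
    (RauzyClass π).ncard = 509 ∧ (RauzyClass σ).ncard = 261 := by
  have encode_eq {τ : Equiv.Perm (Fin 7)} {w : Fin 7 → Fin 7} (h : ∀ i, τ⁻¹ i = w i) :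
      encodePerm τ = encodeWord fun i => (w (Fin.ofNat 7 i)).val := by
    simp only [encodePerm, h]
  constructor
  · refine ncard_rauzyClass_eq 1100 28437 ((encode_eq hπ).trans ?_) ?_ <;> decide +kernel
  · refine ncard_rauzyClass_eq 1100 30993 ((encode_eq hσ).trans ?_) ?_ <;> decide +kernel
end
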